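/- arXiv:0808.2977 — 2 statements merged into one kernel-verified Lean document; each statement's English description precedes it below -/
import Mathlib

section
/- For every r_h > 0, Λ < 0, S_h > 0 and (w_1, …, w_{N−1}) ∈ ℝ^{N−1} satisfying the non-extremality condition 2r_h²·p_θ(r_h) < 1 − Λr_h² (where p_θ(r_h) = (1/(4r_h⁴))Σ_{j=1}^{N}(w_j² − w_{j−1}² − N − 1 + 2j)² with w_0 = w_N = 0), there exist ε > 0 and a solution (m, S, ω_1, …, ω_{N−1}) of the su(N) EYM field equations on [r_h, r_h + ε), analytic in r at r = r_h, such that m(r_h) = (r_h − Λr_h³/3)/2 (so that μ(r_h) = 0), ω_j(r_h) = w_j, S(r_h) = S_h, and ω_j′(r_h) = −W_j(r_h)w_j/(2m(r_h) − 2r_h³p_θ(r_h) − (2Λ/3)r_h³). Moreover the solution depends analytically on (r, r_h, Λ, w_1, …, w_{N−1}, S_h); for fixed Λ this is an (N+2)-parameter family of local black hole solutions near the event horizon. -/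
open Filter Asymptotics Topology

noncomputable section

/-- μ(r) = 1 − 2m(r)/r − Λr²/3. -/
def muF (Λ : ℝ) (m : ℝ → ℝ) (r : ℝ) : ℝ := 1 - 2 * m r / r - Λ * r ^ 2 / 3

/-- G = Σ_{j=1}^{N−1} (ω_j′)². -/
def GF (N : ℕ) (ω : ℕ → ℝ → ℝ) (r : ℝ) : ℝ :=
  ∑ j ∈ Finset.Icc 1 (N - 1), deriv (ω j) r ^ 2

/-- p_θ evaluated on a set of gauge-field values `w`. -/
def pThetaVal (N : ℕ) (w : ℕ → ℝ) (r : ℝ) : ℝ :=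
  1 / (4 * r ^ 4) *
    ∑ j ∈ Finset.Icc 1 N, (w j ^ 2 - w (j - 1) ^ 2 - (N : ℝ) - 1 + 2 * (j : ℝ)) ^ 2

/-- p_θ = (1/4r⁴) Σ_{j=1}^{N} (ω_j² − ω_{j−1}² − N − 1 + 2j)². -/
def pTheta (N : ℕ) (ω : ℕ → ℝ → ℝ) (r : ℝ) : ℝ := pThetaVal N (fun j => ω j r) r

/-- W_j evaluated on gauge-field values `w`. -/
def WVal (w : ℕ → ℝ) (j : ℕ) : ℝ :=
  1 - w j ^ 2 + 1 / 2 * (w (j - 1) ^ 2 + w (j + 1) ^ 2)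

/-- W_j = 1 − ω_j² + (1/2)(ω_{j−1}² + ω_{j+1}²). -/
def WF (ω : ℕ → ℝ → ℝ) (j : ℕ) (r : ℝ) : ℝ := WVal (fun i => ω i r) j

/-- The static spherically symmetric su(N) EYM field equations at radius `r`:
m′ = μG + r²p_θ, S′ = S·(2G/r), and the N−1 Yang–Mills equations
r²μω_j″ + (2m − 2r³p_θ − (2Λ/3)r³)ω_j′ + W_jω_j = 0, with ω₀ ≡ 0, ω_N ≡ 0. -/
def EYM (N : ℕ) (Λ : ℝ) (m S : ℝ → ℝ) (ω : ℕ → ℝ → ℝ) (r : ℝ) : Prop :=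
  ω 0 r = 0 ∧ ω N r = 0 ∧
  HasDerivAt m (muF Λ m r * GF N ω r + r ^ 2 * pTheta N ω r) r ∧
  HasDerivAt S (S r * (2 * GF N ω r / r)) r ∧
  ∀ j ∈ Finset.Icc 1 (N - 1),
    DifferentiableAt ℝ (ω j) r ∧ DifferentiableAt ℝ (deriv (ω j)) r ∧
    r ^ 2 * muF Λ m r * deriv (deriv (ω j)) r
      + (2 * m r - 2 * r ^ 3 * pTheta N ω r - 2 * Λ * r ^ 3 / 3) * deriv (ω j) r
      + WF ω j r * ω j r = 0

/-- Boundary conditions at infinity: m → M, S → 1, ω_j → ω_{j,∞} as r → ∞. -/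
def BCInfinity (N : ℕ) (m S : ℝ → ℝ) (ω : ℕ → ℝ → ℝ) : Prop :=
  (∃ M : ℝ, Tendsto m atTop (𝓝 M)) ∧ Tendsto S atTop (𝓝 1) ∧
  ∀ j ∈ Finset.Icc 1 (N - 1), ∃ w : ℝ, Tendsto (ω j) atTop (𝓝 w)

/-- `f` has exactly `k` zeros in the set `s`. -/
def HasExactlyZeros (f : ℝ → ℝ) (s : Set ℝ) (k : ℕ) : Prop :=
  {r ∈ s | f r = 0}.Finite ∧ {r ∈ s | f r = 0}.ncard = k

/-- Extend horizon values (w_1, …, w_{N−1}) to all of ℕ with w_0 = w_N = 0. -/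
def extendW (N : ℕ) (w : Fin (N - 1) → ℝ) : ℕ → ℝ :=
  fun j => if h : 0 < j ∧ j < N then w ⟨j - 1, by omega⟩ else 0

namespace HorizonODE

section Superposition

variable {K E F : Type*} [TopologicalSpace K] [CompactSpace K]
  [NormedAddCommGroup E] [NormedSpace ℝ E] [NormedAddCommGroup F] [NormedSpace ℝ F]

/-- The pointwise action of a continuous multilinear map on continuous functions. -/
def liftMultilinear {n : ℕ} (p : ContinuousMultilinearMap ℝ (fun _ : Fin n => E) F) :
    ContinuousMultilinearMap ℝ (fun _ : Fin n => C(K, E)) C(K, F) :=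
  MultilinearMap.mkContinuous
    { toFun := fun u => ⟨fun y => p fun i => u i y, by fun_prop⟩
      map_update_add' := by
        intro _ u i v v'
        ext y
        have h : ∀ z : C(K, E), (fun j => Function.update u i z j y) =
            Function.update (fun j => u j y) i (z y) := by
          intro z
          funext j
          rcases eq_or_ne j i with rfl | hj <;> simp [*]
        simp [h]
      map_update_smul' := by
        intro _ u i c v
        ext y
        have h : ∀ z : C(K, E), (fun j => Function.update u i z j y) =
            Function.update (fun j => u j y) i (z y) := by
          intro z
          funext j
          rcases eq_or_ne j i with rfl | hj <;> simp [*]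
        simp [h] }
    ‖p‖ (by
      intro u
      rw [ContinuousMap.norm_le _ (by positivity)]
      intro y
      refine (p.le_opNorm _).trans ?_
      gcongr with i
      exact (u i).norm_coe_le_norm y)

theorem norm_liftMultilinear_le {n : ℕ}
    (p : ContinuousMultilinearMap ℝ (fun _ : Fin n => E) F) :
    ‖(liftMultilinear p : ContinuousMultilinearMap ℝ (fun _ : Fin n => C(K, E)) C(K, F))‖ ≤ ‖p‖ :=
  MultilinearMap.mkContinuous_norm_le _ (norm_nonneg _) _

/-- The superposition operator of an analytic map is analytic at constant functions. -/
theorem exists_analyticAt_superposition [CompleteSpace F] {φ : E → F} {e : E}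
    (hφ : AnalyticAt ℝ φ e) :
    ∃ Φ : C(K, E) → C(K, F), AnalyticAt ℝ Φ (ContinuousMap.const K e) ∧
      ∀ᶠ u in 𝓝 (ContinuousMap.const K e), ∀ y, Φ u y = φ (u y) := by
  obtain ⟨p, r, hp⟩ := hφ
  let P : FormalMultilinearSeries ℝ C(K, E) C(K, F) := fun n => liftMultilinear (p n)
  have hr : p.radius ≤ P.radius :=
    FormalMultilinearSeries.radius_le_of_le fun {n} => norm_liftMultilinear_le (p n)
  have hP : 0 < P.radius := hp.radius_pos.trans_le hr
  have hS := (P.hasFPowerSeriesOnBall hP).comp_sub (ContinuousMap.const K e)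
  rw [zero_add] at hS
  refine ⟨_, hS.analyticAt, ?_⟩
  filter_upwards [Metric.eball_mem_nhds (ContinuousMap.const K e) hp.r_pos] with u hu y
  have hu' : u - ContinuousMap.const K e ∈ Metric.eball (0 : C(K, E)) r := by
    simpa [edist_eq_enorm_sub] using hu
  have hs : HasSum (fun n => P n fun _ => u - ContinuousMap.const K e)
      (P.sum (u - ContinuousMap.const K e)) :=
    P.hasSum (Metric.eball_subset_eball (hp.r_le.trans hr) hu')
  have hs' := (ContinuousMap.evalCLM ℝ y).hasSum hs
  have hy : u y - e ∈ Metric.eball (0 : E) r := by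
    have h1 : ‖(u - ContinuousMap.const K e) y‖ₑ ≤ ‖u - ContinuousMap.const K e‖ₑ := by
      have := (u - ContinuousMap.const K e).norm_coe_le_norm y
      rw [← ofReal_norm, ← ofReal_norm]
      exact ENNReal.ofReal_le_ofReal this
    simp only [Metric.mem_eball, edist_zero_right] at hu' ⊢
    exact h1.trans_lt hu'
  have hφs := hp.hasSum hy
  rw [add_sub_cancel] at hφs
  exact hs'.unique hφs

end Superposition

section FixedPoint

variable {Q X : Type*} [NormedAddCommGroup Q] [NormedSpace ℝ Q] [CompleteSpace Q]
  [NormedAddCommGroup X] [NormedSpace ℝ X] [CompleteSpace X]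

/-- An analytic family of maps that is constant at one parameter has an analytic, locally unique
family of fixed points. -/
theorem exists_analyticAt_fixedPoint_of_eventually_const {T : Q × X → X} {q : Q} {x : X}
    (hT : AnalyticAt ℝ T (q, x)) (hc : ∀ᶠ y in 𝓝 x, T (q, y) = x) :
    ∃ g : Q → X, AnalyticAt ℝ g q ∧ g q = x ∧
      ∀ᶠ z in 𝓝 (q, x), z.2 = T z ↔ z.2 = g z.1 := by
  have hf : AnalyticAt ℝ (fun z : Q × X => z.2 - T z) (q, x) := analyticAt_snd.sub hT
  have hx : T (q, x) = x := hc.self_of_nhds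
  have hder : fderiv ℝ (fun z : Q × X => z.2 - T z) (q, x) ∘L .inr ℝ Q X
      = ContinuousLinearMap.id ℝ X := by
    have h1 : HasFDerivAt (fun y : X => y - T (q, y))
        (fderiv ℝ (fun z : Q × X => z.2 - T z) (q, x) ∘L .inr ℝ Q X) x :=
      hf.differentiableAt.hasFDerivAt.comp x (hasFDerivAt_prodMk_right q x)
    have h2 : HasFDerivAt (fun y : X => y - T (q, y)) (ContinuousLinearMap.id ℝ X) x := by
      refine ((hasFDerivAt_id x).sub_const x).congr_of_eventuallyEq ?_
      filter_upwards [hc] with y hy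
      simp [hy]
    exact h1.unique h2
  have hinv : (fderiv ℝ (fun z : Q × X => z.2 - T z) (q, x) ∘L .inr ℝ Q X).IsInvertible :=
    hder ▸ ⟨ContinuousLinearEquiv.refl ℝ X, rfl⟩
  have hcd : ContDiffAt ℝ ⊤ (fun z : Q × X => z.2 - T z) (q, x) := hf.contDiffAt
  refine ⟨hcd.implicitFunction (by simp) hinv,
    (hcd.contDiffAt_implicitFunction (by simp) hinv).analyticAt,
    hcd.implicitFunction_apply_self (by simp) hinv, ?_⟩
  filter_upwards [hcd.eventually_apply_eq_iff_implicitFunction (by simp) hinv] with z hz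
  rw [eq_comm (b := ContDiffAt.implicitFunction _ _ _ _), ← hz, hx, sub_self, sub_eq_zero]

/-- As `exists_analyticAt_fixedPoint_of_eventually_const`, when only the second iterate is
constant. -/
theorem exists_analyticAt_fixedPoint {T : Q × X → X} {q : Q} {x : X}
    (hT : AnalyticAt ℝ T (q, x)) (hx : T (q, x) = x)
    (hc : ∀ᶠ y in 𝓝 x, T (q, T (q, y)) = x) :
    ∃ g : Q → X, AnalyticAt ℝ g q ∧ g q = x ∧
      ∀ᶠ z in 𝓝 (q, x), z.2 = T z ↔ z.2 = g z.1 := by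
  have hpair : AnalyticAt ℝ (fun z : Q × X => (z.1, T z)) (q, x) := analyticAt_fst.prod hT
  have hpx : (fun z : Q × X => (z.1, T z)) (q, x) = (q, x) := by simp [hx]
  have hT2 : AnalyticAt ℝ (fun z : Q × X => T (z.1, T z)) (q, x) :=
    AnalyticAt.fun_comp (by rw [hx]; exact hT) hpair
  obtain ⟨g, hg, hgq, hiff⟩ := exists_analyticAt_fixedPoint_of_eventually_const hT2 hc
  refine ⟨g, hg, hgq, ?_⟩
  have htend : Tendsto (fun z : Q × X => (z.1, T z)) (𝓝 (q, x)) (𝓝 (q, x)) := by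
    simpa only [ContinuousAt, hx] using hpair.continuousAt
  filter_upwards [hiff, htend.eventually hiff] with z hz hz'
  constructor
  · intro h
    exact hz.1 (by rw [← h]; exact h)
  · intro h
    have h1 := hz.2 h
    rw [h, ← hz'.1 (by rw [← h1])]

end FixedPoint

section LocalExistence

open unitInterval

/-- The averaging operator `f ↦ (y ↦ ∫₀¹ f (t y) dt)`. -/
def average (F : Type*) [NormedAddCommGroup F] [NormedSpace ℝ F] : C(I, F) →L[ℝ] C(I, F) :=
  LinearMap.mkContinuous
    { toFun := fun f =>
        ⟨fun y => ∫ t in (0 : ℝ)..1, f (Set.projIcc 0 1 zero_le_one t * y), by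
          apply intervalIntegral.continuous_parametric_intervalIntegral_of_continuous'
          fun_prop⟩
      map_add' := fun f g => by
        ext y
        exact intervalIntegral.integral_add
          (Continuous.intervalIntegrable (by fun_prop) _ _)
          (Continuous.intervalIntegrable (by fun_prop) _ _)
      map_smul' := fun c f => by
        ext y
        exact intervalIntegral.integral_smul c _ }
    1 (by
      intro f
      rw [ContinuousMap.norm_le _ (by positivity)]
      intro y
      have := intervalIntegral.norm_integral_le_of_norm_le_const (a := (0 : ℝ)) (b := 1)
        (f := fun t => f (Set.projIcc 0 1 zero_le_one t * y)) (C := ‖f‖)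
        (fun t _ => f.norm_coe_le_norm _)
      simpa using this)

/-- The operator `f ↦ (y ↦ ∫₀ʸ f)`, written through `average`. -/
def primitive (F : Type*) [NormedAddCommGroup F] [NormedSpace ℝ F] : C(I, F) →L[ℝ] C(I, F) :=
  LinearMap.mkContinuous
    { toFun := fun f => ⟨fun y => (y : ℝ) • average F f y, by fun_prop⟩
      map_add' := fun f g => by ext y; simp
      map_smul' := fun c f => by ext y; simp [smul_comm c] }
    ‖average F‖ (by
      intro f
      rw [ContinuousMap.norm_le _ (by positivity)]
      intro y
      change ‖(y : ℝ) • average F f y‖ ≤ _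
      rw [norm_smul, Real.norm_of_nonneg y.2.1]
      calc (y : ℝ) * ‖average F f y‖ ≤ 1 * ‖average F f‖ :=
            mul_le_mul y.2.2 ((average F f).norm_coe_le_norm y) (norm_nonneg _) zero_le_one
        _ ≤ _ := by rw [one_mul]; exact (average F).le_opNorm f)

variable {P U V : Type*} [NormedAddCommGroup P] [NormedSpace ℝ P]
  [NormedAddCommGroup U] [NormedSpace ℝ U] [NormedAddCommGroup V] [NormedSpace ℝ V]

theorem average_apply (f : C(I, V)) (y : I) :
    average V f y = ∫ t in (0 : ℝ)..1, f (Set.projIcc 0 1 zero_le_one t * y) := rfl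

theorem primitive_apply (f : C(I, V)) (y : I) :
    primitive V f y = (y : ℝ) • average V f y := rfl

variable (P U V) in
/-- The map sending `((s, p), (a, b))` to the curve `y ↦ (s y, p, a y, b y)`. -/
def graphCurve : (ℝ × P) × (C(I, U) × C(I, V)) →L[ℝ] C(I, ℝ × P × U × V) :=
  LinearMap.mkContinuous
    { toFun := fun z => ⟨fun y => (z.1.1 * y, z.1.2, z.2.1 y, z.2.2 y), by fun_prop⟩
      map_add' := fun z w => by ext y <;> simp [add_mul]
      map_smul' := fun c z => by ext y <;> simp [mul_assoc] }
    1 (by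
      intro z
      rw [ContinuousMap.norm_le _ (by positivity), one_mul]
      intro y
      have h1 : ‖z.1.1 * (y : ℝ)‖ ≤ ‖z‖ := by
        rw [norm_mul, Real.norm_of_nonneg y.2.1]
        exact (mul_le_of_le_one_right (norm_nonneg _) y.2.2).trans
          ((norm_fst_le z.1).trans (norm_fst_le z))
      have h2 : ‖z.1.2‖ ≤ ‖z‖ := (norm_snd_le z.1).trans (norm_fst_le z)
      have h3 : ‖z.2.1 y‖ ≤ ‖z‖ :=
        (z.2.1.norm_coe_le_norm y).trans ((norm_fst_le z.2).trans (norm_snd_le z))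
      have h4 : ‖z.2.2 y‖ ≤ ‖z‖ :=
        (z.2.2.norm_coe_le_norm y).trans ((norm_snd_le z.2).trans (norm_snd_le z))
      exact max_le h1 (max_le h2 (max_le h3 h4)))

theorem graphCurve_apply (z : (ℝ × P) × (C(I, U) × C(I, V))) (y : I) :
    graphCurve P U V z y = (z.1.1 * y, z.1.2, z.2.1 y, z.2.2 y) := rfl

/-- `h` solves `(x a)' = A (x, p, a, b)`, `b' = B (x, p, a, b)`, `b 0 = b₀ p` in integrated form
on `|x| < δ`. -/
def IsIntegralSolution (A : ℝ × P × U × V → U) (B : ℝ × P × U × V → V) (b₀ : P → V) (p : P)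
    (δ : ℝ) (h : ℝ → U × V) : Prop :=
  ∀ x, |x| < δ →
    (h x).1 = (∫ t in (0 : ℝ)..1, A (x * t, p, h (x * t))) ∧
    (h x).2 = b₀ p + x • ∫ t in (0 : ℝ)..1, B (x * t, p, h (x * t))

variable [CompleteSpace P] [CompleteSpace U] [CompleteSpace V]

/-- Analytic dependence on parameters and local uniqueness for a system with a regular singular
point, `(x a)' = A (x, p, a, b)`, `b' = B (x, p, a, b)`. -/
theorem exists_analyticAt_integralSolution {A : ℝ × P × U × V → U} {B : ℝ × P × U × V → V}
    {b₀ : P → V} {p₀ : P} {a₀ : U} (hA₀ : ∀ a, A (0, p₀, a, b₀ p₀) = a₀)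
    (hA : AnalyticAt ℝ A (0, p₀, a₀, b₀ p₀)) (hB : AnalyticAt ℝ B (0, p₀, a₀, b₀ p₀))
    (hb : AnalyticAt ℝ b₀ p₀) :
    ∃ f : P × ℝ → U × V, AnalyticAt ℝ f (p₀, 0) ∧
      (∃ δ > 0, ∀ p, dist p p₀ < δ → IsIntegralSolution A B b₀ p δ fun x => f (p, x)) ∧
      ∀ (h : ℝ → U × V) (δ : ℝ), 0 < δ → ContinuousOn h (Metric.ball 0 δ) →
        IsIntegralSolution A B b₀ p₀ δ h → h =ᶠ[𝓝 0] fun x => f (p₀, x) := by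
  obtain ⟨ΦA, hΦA, hΦA'⟩ := exists_analyticAt_superposition (K := I) hA
  obtain ⟨ΦB, hΦB, hΦB'⟩ := exists_analyticAt_superposition (K := I) hB
  let x₀ : C(I, U) × C(I, V) := (.const I a₀, .const I (b₀ p₀))
  let z₀ : (ℝ × P) × (C(I, U) × C(I, V)) := ((0, p₀), x₀)
  let T : (ℝ × P) × (C(I, U) × C(I, V)) → C(I, U) × C(I, V) := fun z =>
    (average U (ΦA (graphCurve P U V z)),
      ContinuousLinearMap.const ℝ I (b₀ z.1.2) + z.1.1 • primitive V (ΦB (graphCurve P U V z)))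
  have hgz : graphCurve P U V z₀ = .const I (0, p₀, a₀, b₀ p₀) := by
    ext y <;> simp [graphCurve_apply, z₀, x₀]
  have hgA : AnalyticAt ℝ (graphCurve P U V) z₀ := ContinuousLinearMap.analyticAt _ _
  have hT : AnalyticAt ℝ T z₀ := by
    refine AnalyticAt.prod ?_ (AnalyticAt.fun_add ?_ (AnalyticAt.fun_smul ?_ ?_))
    · exact ((average U).analyticAt _).fun_comp (AnalyticAt.fun_comp (by rwa [hgz]) hgA)
    · refine (ContinuousLinearMap.analyticAt _ _).fun_comp (AnalyticAt.fun_comp (g := b₀) hb ?_)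
      exact analyticAt_snd.fun_comp analyticAt_fst
    · exact analyticAt_fst.fun_comp analyticAt_fst
    · exact ((primitive V).analyticAt _).fun_comp (AnalyticAt.fun_comp (by rwa [hgz]) hgA)
  have htend : Tendsto (graphCurve P U V) (𝓝 z₀) (𝓝 (.const I (0, p₀, a₀, b₀ p₀))) := by
    rw [← hgz]; exact (graphCurve P U V).continuous.continuousAt
  have hpt : ∀ᶠ z in 𝓝 z₀,
      (∀ y, (T z).1 y = ∫ t in (0 : ℝ)..1, A (graphCurve P U V z
        (Set.projIcc 0 1 zero_le_one t * y))) ∧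
      ∀ y, (T z).2 y = b₀ z.1.2 + (z.1.1 * y) • ∫ t in (0 : ℝ)..1, B (graphCurve P U V z
        (Set.projIcc 0 1 zero_le_one t * y)) := by
    filter_upwards [htend.eventually hΦA', htend.eventually hΦB'] with z hz hz'
    refine ⟨fun y => ?_, fun y => ?_⟩
    · simp only [T, average_apply, hz]
    · simp only [T, ContinuousMap.add_apply, ContinuousMap.smul_apply, primitive_apply,
        average_apply, hz', smul_smul]
      rfl
  have hT2 : ∀ x, (T ((0, p₀), x)).2 = .const I (b₀ p₀) := by
    intro x
    ext y
    simp [T]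
  have hT1 : ∀ᶠ z in 𝓝 z₀, z.1 = (0, p₀) → z.2.2 = .const I (b₀ p₀) → T z = x₀ := by
    filter_upwards [hpt] with z hz h1 h2
    refine Prod.ext ?_ ?_
    · ext y
      rw [hz.1]
      simp [graphCurve_apply, h1, h2, hA₀, x₀]
    · rw [show z = ((0, p₀), z.2) from Prod.ext h1 rfl, hT2]
  have hTx : T z₀ = x₀ := hT1.self_of_nhds rfl rfl
  have hTT : ∀ᶠ y in 𝓝 x₀, T ((0, p₀), T ((0, p₀), y)) = x₀ := by
    have h1 : Tendsto (fun y => (((0 : ℝ), p₀), T ((0, p₀), y))) (𝓝 x₀) (𝓝 z₀) := by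
      have h2 : Tendsto (fun y => (((0 : ℝ), p₀), y)) (𝓝 x₀) (𝓝 z₀) :=
        (Continuous.prodMk_right _).tendsto x₀
      have h3 : Tendsto T (𝓝 z₀) (𝓝 x₀) := by
        have := hT.continuousAt.tendsto
        rwa [hTx] at this
      exact tendsto_const_nhds.prodMk_nhds (h3.comp h2)
    filter_upwards [h1.eventually hT1] with y hy
    exact hy rfl (hT2 y)
  obtain ⟨g, hg, hg0, hiff⟩ := exists_analyticAt_fixedPoint hT hTx hTT
  obtain ⟨η, hη, hball⟩ := Metric.eventually_nhds_iff.1 (hpt.and hiff)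
  obtain ⟨δ₁, hδ₁, hclose⟩ := Metric.continuousAt_iff.1 hg.continuousAt η hη
  rw [hg0] at hclose
  have hdist : ∀ (s : ℝ) (p : P) (u : C(I, U) × C(I, V)), |s| < η → dist p p₀ < η →
      dist u x₀ < η → dist ((s, p), u) z₀ < η := by
    intro s p u h1 h2 h3
    rw [← Real.norm_eq_abs, ← dist_zero_right] at h1
    exact max_lt (max_lt h1 h2) h3
  have hδ : 0 < min η δ₁ := lt_min hη hδ₁
  have hgη : ∀ (s : ℝ) (p : P), |s| < min η δ₁ → dist p p₀ < min η δ₁ →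
      dist (g (s, p)) x₀ < η := by
    intro s p hs hp
    refine hclose (max_lt ?_ (hp.trans_le (min_le_right _ _)))
    simpa using hs.trans_le (min_le_right _ _)
  have hdil : ∀ (s : ℝ) (p : P) (τ : I), |s| < min η δ₁ → dist p p₀ < min η δ₁ →
      (g (s, p)).1 τ = (g (s * τ, p)).1 1 ∧ (g (s, p)).2 τ = (g (s * τ, p)).2 1 := by
    intro s p τ hs hp
    have hsη := hs.trans_le (min_le_left _ _)
    have hpη := hp.trans_le (min_le_left _ _)
    have hsτ : |s * τ| ≤ |s| := by
      rw [abs_mul, abs_of_nonneg τ.2.1]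
      exact mul_le_of_le_one_right (abs_nonneg _) τ.2.2
    set u := g (s, p) with hu
    have huη := hgη s p hs hp
    obtain ⟨⟨e1, e2⟩, e3⟩ := hball (hdist s p u hsη hpη huη)
    have hfix := e3.2 rfl
    let d : C(I, I) := ⟨fun y => τ * y, by fun_prop⟩
    let v : C(I, U) × C(I, V) := (u.1.comp d, u.2.comp d)
    have hv : dist v x₀ < η := by
      refine max_lt ((ContinuousMap.dist_lt_iff hη).2 fun y => ?_)
        ((ContinuousMap.dist_lt_iff hη).2 fun y => ?_)
      · exact (ContinuousMap.dist_apply_le_dist (f := u.1) (g := x₀.1) (τ * y)).trans_lt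
          ((le_max_left _ _).trans_lt huη)
      · exact (ContinuousMap.dist_apply_le_dist (f := u.2) (g := x₀.2) (τ * y)).trans_lt
          ((le_max_right _ _).trans_lt huη)
    obtain ⟨⟨c1, c2⟩, c3⟩ := hball (hdist (s * τ) p v (hsτ.trans_lt hsη) hpη hv)
    have hgr : ∀ y : I, graphCurve P U V ((s * τ, p), v) y = graphCurve P U V ((s, p), u) (τ * y) :=
      fun y => by simp [graphCurve_apply, v, d, mul_assoc]
    have hvT : v = T ((s * τ, p), v) := by
      refine Prod.ext ?_ ?_
      · ext y
        rw [c1]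
        simp only [hgr, mul_left_comm τ]
        rw [← e1, ← hfix]
        rfl
      · ext y
        rw [c2]
        simp only [hgr, mul_left_comm τ]
        have := e2 (τ * y)
        rw [← hfix] at this
        rw [mul_assoc]
        exact this
    have hvg : v = g (s * τ, p) := c3.1 hvT
    rw [← hvg]
    simp [v, d]
  refine ⟨fun q => ((g (q.2, q.1)).1 1, (g (q.2, q.1)).2 1), ?_, ⟨min η δ₁, hδ, ?_⟩, ?_⟩
  · have hg' : AnalyticAt ℝ (fun q : P × ℝ => g (q.2, q.1)) (p₀, 0) :=
      AnalyticAt.fun_comp (g := g) hg (analyticAt_snd.prod analyticAt_fst)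
    exact (((ContinuousMap.evalCLM ℝ (1 : I)).analyticAt _).fun_comp
      (analyticAt_fst.fun_comp hg')).prod
      (((ContinuousMap.evalCLM ℝ (1 : I)).analyticAt _).fun_comp (analyticAt_snd.fun_comp hg'))
  · intro p hp s hs
    obtain ⟨⟨e1, e2⟩, e3⟩ := hball (hdist s p (g (s, p)) (hs.trans_le (min_le_left _ _))
      (hp.trans_le (min_le_left _ _)) (hgη s p hs hp))
    have hfix : g (s, p) = T ((s, p), g (s, p)) := e3.2 rfl
    rw [← hfix] at e1 e2
    have hint : ∀ t ∈ Set.uIcc (0 : ℝ) 1, graphCurve P U V ((s, p), g (s, p))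
        (Set.projIcc 0 1 zero_le_one t * 1)
        = (s * t, p, ((g (s * t, p)).1 1, (g (s * t, p)).2 1)) := by
      intro t ht
      rw [Set.uIcc_of_le zero_le_one] at ht
      have := hdil s p ⟨t, ht⟩ hs hp
      rw [Set.projIcc_of_mem _ ht, mul_one, graphCurve_apply]
      simp only [this]
    refine ⟨(e1 1).trans (intervalIntegral.integral_congr fun t ht => ?_), (e2 1).trans ?_⟩
    · exact congrArg A (hint t ht)
    · rw [show ((1 : I) : ℝ) = 1 from rfl, mul_one]
      congr 2
      exact intervalIntegral.integral_congr fun t ht => congrArg B (hint t ht)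
  · intro h δ hδ0 hcont hsol
    have h0 : h 0 = (a₀, b₀ p₀) := by
      have h1 := (hsol 0 (by simpa using hδ0)).2
      have h2 := (hsol 0 (by simpa using hδ0)).1
      simp only [zero_smul, add_zero, zero_mul, intervalIntegral.integral_const, sub_zero,
        one_smul] at h1 h2
      refine Prod.ext ?_ h1
      rw [h2, show h 0 = ((h 0).1, b₀ p₀) from Prod.ext rfl h1, hA₀]
    have hc0 : ContinuousAt h 0 := hcont.continuousAt (Metric.ball_mem_nhds _ hδ0)
    obtain ⟨δ₂, hδ₂, hclose₂⟩ := Metric.continuousAt_iff.1 hc0 η hη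
    rw [h0] at hclose₂
    have hev : ∀ᶠ s : ℝ in 𝓝 0, dist s 0 < min (min η δ₁) (min δ δ₂) :=
      Metric.ball_mem_nhds _ (lt_min hδ (lt_min hδ0 hδ₂))
    filter_upwards [hev] with s hs
    rw [dist_zero_right, Real.norm_eq_abs, lt_min_iff, lt_min_iff, lt_min_iff] at hs
    obtain ⟨⟨hs1, hs2⟩, hs3, hs4⟩ := hs
    have hsy : ∀ y : I, |s * y| ≤ |s| := by
      intro y
      rw [abs_mul, abs_of_nonneg y.2.1]
      exact mul_le_of_le_one_right (abs_nonneg _) y.2.2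
    have hc : Continuous fun y : I => h (s * y) := by
      refine hcont.comp_continuous (by fun_prop) fun y => ?_
      simpa using (hsy y).trans_lt hs3
    let v : C(I, U) × C(I, V) := (⟨fun y => (h (s * y)).1, hc.fst⟩,
      ⟨fun y => (h (s * y)).2, hc.snd⟩)
    have hhy : ∀ y : I, dist (h (s * y)) (a₀, b₀ p₀) < η := fun y =>
      hclose₂ (by simpa using (hsy y).trans_lt hs4)
    have hv : dist v x₀ < η := by
      refine max_lt ((ContinuousMap.dist_lt_iff hη).2 fun y => ?_)
        ((ContinuousMap.dist_lt_iff hη).2 fun y => ?_)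
      · exact (le_max_left _ _).trans_lt (hhy y)
      · exact (le_max_right _ _).trans_lt (hhy y)
    obtain ⟨⟨c1, c2⟩, c3⟩ := hball (hdist s p₀ v hs1 (by simpa using hη) hv)
    have hint : ∀ y : I, ∀ t ∈ Set.uIcc (0 : ℝ) 1, graphCurve P U V ((s, p₀), v)
        (Set.projIcc 0 1 zero_le_one t * y) = (s * y * t, p₀, h (s * y * t)) := by
      intro y t ht
      rw [Set.uIcc_of_le zero_le_one] at ht
      rw [Set.projIcc_of_mem _ ht, graphCurve_apply]
      simp [v, mul_comm t, mul_assoc]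
    have hvT : v = T ((s, p₀), v) := by
      refine Prod.ext ?_ ?_
      · ext y
        rw [c1]
        refine (hsol (s * y) ((hsy y).trans_lt hs3)).1.trans ?_
        exact intervalIntegral.integral_congr fun t ht => (congrArg A (hint y t ht)).symm
      · ext y
        rw [c2]
        refine (hsol (s * y) ((hsy y).trans_lt hs3)).2.trans ?_
        congr 2
        exact intervalIntegral.integral_congr fun t ht => (congrArg B (hint y t ht)).symm
    have hvg : v = g (s, p₀) := c3.1 hvT
    rw [← hvg]
    simp [v]

end LocalExistence

section GlobalFamily

variable {P U V : Type*} [NormedAddCommGroup P] [NormedSpace ℝ P]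
  [NormedAddCommGroup U] [NormedSpace ℝ U] [NormedAddCommGroup V] [NormedSpace ℝ V]

theorem hasDerivAt_smul_average {F : Type*} [NormedAddCommGroup F] [NormedSpace ℝ F]
    [CompleteSpace F] {k : ℝ → F} {δ : ℝ} (hk : ContinuousOn k (Metric.ball 0 δ)) {x : ℝ}
    (hx : |x| < δ) : HasDerivAt (fun x => x • ∫ t in (0 : ℝ)..1, k (x * t)) (k x) x := by
  simp only [intervalIntegral.smul_integral_comp_mul_left, mul_zero, mul_one]
  have hxb : x ∈ Metric.ball (0 : ℝ) δ := by simpa using hx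
  have h0b : (0 : ℝ) ∈ Metric.ball (0 : ℝ) δ := by simpa using (abs_nonneg x).trans_lt hx
  refine intervalIntegral.integral_hasDerivAt_right
    (ContinuousOn.intervalIntegrable (hk.mono ?_))
    (hk.stronglyMeasurableAtFilter Metric.isOpen_ball x hxb)
    (hk.continuousAt (Metric.isOpen_ball.mem_nhds hxb))
  rw [← segment_eq_uIcc]
  exact (convex_ball _ _).segment_subset h0b hxb

/-- Solutions in integrated form solve the differential equations. -/
theorem IsIntegralSolution.eventually_hasDerivAt [CompleteSpace U] [CompleteSpace V]
    {A : ℝ × P × U × V → U} {B : ℝ × P × U × V → V} {b₀ : P → V} {p : P} {δ : ℝ}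
    {h : ℝ → U × V} (hδ : 0 < δ) (hsol : IsIntegralSolution A B b₀ p δ h)
    (hh : AnalyticAt ℝ h 0) (hA : AnalyticAt ℝ A (0, p, h 0)) (hB : AnalyticAt ℝ B (0, p, h 0)) :
    ∀ᶠ x in 𝓝 (0 : ℝ), HasDerivAt (fun x => x • (h x).1) (A (x, p, h x)) x ∧
      HasDerivAt (fun x => (h x).2) (B (x, p, h x)) x := by
  have hc : AnalyticAt ℝ (fun x : ℝ => (x, p, h x)) 0 :=
    analyticAt_id.prod (analyticAt_const.prod hh)
  have hkA : AnalyticAt ℝ (fun x => A (x, p, h x)) 0 := AnalyticAt.fun_comp (g := A) hA hc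
  have hkB : AnalyticAt ℝ (fun x => B (x, p, h x)) 0 := AnalyticAt.fun_comp (g := B) hB hc
  obtain ⟨δ', hδ', hball⟩ := Metric.eventually_nhds_iff.1
    (hkA.eventually_analyticAt.and hkB.eventually_analyticAt)
  have hA' : ContinuousOn (fun x => A (x, p, h x)) (Metric.ball 0 δ') :=
    fun x hx => (hball hx).1.continuousAt.continuousWithinAt
  have hB' : ContinuousOn (fun x => B (x, p, h x)) (Metric.ball 0 δ') :=
    fun x hx => (hball hx).2.continuousAt.continuousWithinAt
  have hev : ∀ᶠ x in 𝓝 (0 : ℝ), |x| < δ := by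
    simpa [Filter.Eventually, Metric.ball, Real.dist_eq] using Metric.ball_mem_nhds (0 : ℝ) hδ
  have hev' : ∀ᶠ x in 𝓝 (0 : ℝ), |x| < δ' := by
    simpa [Filter.Eventually, Metric.ball, Real.dist_eq] using Metric.ball_mem_nhds (0 : ℝ) hδ'
  filter_upwards [hev.eventually_nhds, hev'] with x hx hx'
  constructor
  · refine (hasDerivAt_smul_average hA' hx').congr_of_eventuallyEq ?_
    filter_upwards [hx] with y hy
    rw [(hsol y hy).1]
  · refine ((hasDerivAt_smul_average hB' hx').const_add (b₀ p)).congr_of_eventuallyEq ?_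
    filter_upwards [hx] with y hy
    rw [(hsol y hy).2]

variable [CompleteSpace P] [CompleteSpace U] [CompleteSpace V]

/-- A family of solutions of `(x a)' = A (x, p, a, b)`, `b' = B (x, p, a, b)`, `b 0 = b₀ p`,
analytic in `(p, x)` near `x = 0`, over an open parameter set. -/
theorem exists_analytic_family {A : ℝ × P × U × V → U} {B : ℝ × P × U × V → V}
    {a₀ : P → U} {b₀ : P → V} {Ω : Set P} (hΩ : IsOpen Ω)
    (hA₀ : ∀ p ∈ Ω, ∀ a, A (0, p, a, b₀ p) = a₀ p)
    (hA : ∀ p ∈ Ω, AnalyticAt ℝ A (0, p, a₀ p, b₀ p))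
    (hB : ∀ p ∈ Ω, AnalyticAt ℝ B (0, p, a₀ p, b₀ p)) (hb : ∀ p ∈ Ω, AnalyticAt ℝ b₀ p) :
    ∃ F : P → ℝ → U × V, ∀ p ∈ Ω, AnalyticAt ℝ (fun q : P × ℝ => F q.1 q.2) (p, 0) ∧
      F p 0 = (a₀ p, b₀ p) ∧
      ∀ᶠ x in 𝓝 (0 : ℝ), HasDerivAt (fun x => x • (F p x).1) (A (x, p, F p x)) x ∧
        HasDerivAt (fun x => (F p x).2) (B (x, p, F p x)) x := by
  have hloc : ∀ p₀ ∈ Ω, ∃ (f : P × ℝ → U × V) (δ : ℝ), 0 < δ ∧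
      (∀ p, dist p p₀ < δ → p ∈ Ω) ∧
      (∀ p x, dist p p₀ < δ → |x| < δ → AnalyticAt ℝ f (p, x)) ∧
      (∀ p, dist p p₀ < δ → IsIntegralSolution A B b₀ p δ fun x => f (p, x)) ∧
      ∀ (h : ℝ → U × V) (δ : ℝ), 0 < δ → ContinuousOn h (Metric.ball 0 δ) →
        IsIntegralSolution A B b₀ p₀ δ h → h =ᶠ[𝓝 0] fun x => f (p₀, x) := by
    intro p₀ hp₀
    obtain ⟨f, hf, ⟨δ₁, hδ₁, hsol⟩, huniq⟩ := exists_analyticAt_integralSolution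
      (hA₀ p₀ hp₀) (hA p₀ hp₀) (hB p₀ hp₀) (hb p₀ hp₀)
    obtain ⟨δ₂, hδ₂, hf'⟩ := Metric.eventually_nhds_iff.1 hf.eventually_analyticAt
    obtain ⟨δ₃, hδ₃, hsub⟩ := Metric.eventually_nhds_iff.1 (hΩ.mem_nhds hp₀)
    refine ⟨f, min δ₁ (min δ₂ δ₃), lt_min hδ₁ (lt_min hδ₂ hδ₃), ?_, ?_, ?_, huniq⟩
    · intro p hp
      exact hsub (hp.trans_le ((min_le_right _ _).trans (min_le_right _ _)))
    · intro p x hp hx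
      refine hf' (max_lt ?_ ?_)
      · exact hp.trans_le ((min_le_right _ _).trans (min_le_left _ _))
      · simpa using hx.trans_le ((min_le_right _ _).trans (min_le_left _ _))
    · intro p hp x hx
      exact hsol p (hp.trans_le (min_le_left _ _)) x (hx.trans_le (min_le_left _ _))
  choose! f δ hδ hsub hf hsol huniq using hloc
  have hline : ∀ p₀ ∈ Ω, ∀ p x, dist p p₀ < δ p₀ → |x| < δ p₀ →
      AnalyticAt ℝ (fun x => f p₀ (p, x)) x := fun p₀ hp₀ p x hp hx =>
    AnalyticAt.fun_comp (g := f p₀) (hf p₀ hp₀ p x hp hx) (analyticAt_const.prod analyticAt_id)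
  have hagree : ∀ p₁ ∈ Ω, ∀ p₂ ∈ Ω, ∀ p x, dist p p₁ < δ p₁ → |x| < δ p₁ →
      dist p p₂ < δ p₂ → |x| < δ p₂ → f p₁ (p, x) = f p₂ (p, x) := by
    intro p₁ hp₁ p₂ hp₂ p x h1 h1' h2 h2'
    have hp := hsub p₁ hp₁ p h1
    have hg : ∀ p' ∈ Ω, dist p p' < δ p' →
        (fun x => f p' (p, x)) =ᶠ[𝓝 0] fun x => f p (p, x) := by
      intro p' hp' hpp'
      refine huniq p hp _ (δ p') (hδ p' hp') (fun y hy => ?_) (hsol p' hp' p hpp')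
      exact (hline p' hp' p y hpp' (by simpa using hy)).continuousAt.continuousWithinAt
    have hpos : 0 < min (δ p₁) (δ p₂) := lt_min (hδ p₁ hp₁) (hδ p₂ hp₂)
    refine AnalyticOnNhd.eqOn_of_preconnected_of_eventuallyEq (𝕜 := ℝ)
      (f := fun x => f p₁ (p, x)) (g := fun x => f p₂ (p, x))
      (U := Metric.ball 0 (min (δ p₁) (δ p₂))) (z₀ := 0) (fun y hy => ?_) (fun y hy => ?_)
      (convex_ball _ _).isPreconnected (Metric.mem_ball_self hpos)
      ((hg p₁ hp₁ h1).trans (hg p₂ hp₂ h2).symm) (by simpa using ⟨h1', h2'⟩)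
    · have hy' : |y| < min (δ p₁) (δ p₂) := by simpa using hy
      exact hline p₁ hp₁ p y h1 (hy'.trans_le (min_le_left _ _))
    · have hy' : |y| < min (δ p₁) (δ p₂) := by simpa using hy
      exact hline p₂ hp₂ p y h2 (hy'.trans_le (min_le_right _ _))
  classical
  let F : P → ℝ → U × V := fun p x =>
    if h : ∃ p₁ ∈ Ω, dist p p₁ < δ p₁ ∧ |x| < δ p₁ then f h.choose (p, x) else 0
  have hF : ∀ p₀ ∈ Ω, ∀ p x, dist p p₀ < δ p₀ → |x| < δ p₀ → F p x = f p₀ (p, x) := by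
    intro p₀ hp₀ p x hp hx
    have h : ∃ p₁ ∈ Ω, dist p p₁ < δ p₁ ∧ |x| < δ p₁ := ⟨p₀, hp₀, hp, hx⟩
    simp only [F, dif_pos h]
    exact hagree _ h.choose_spec.1 p₀ hp₀ p x h.choose_spec.2.1 h.choose_spec.2.2 hp hx
  refine ⟨F, fun p hp => ?_⟩
  have hpp : dist p p < δ p := by simpa using hδ p hp
  have hFan : AnalyticAt ℝ (fun q : P × ℝ => F q.1 q.2) (p, 0) := by
    refine (hf p hp p 0 hpp (by simpa using hδ p hp)).congr ?_
    filter_upwards [Metric.ball_mem_nhds (p, (0 : ℝ)) (hδ p hp)] with q hq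
    obtain ⟨h1, h2⟩ := max_lt_iff.1 (Metric.mem_ball.1 hq)
    exact (hF p hp q.1 q.2 h1 (by simpa using h2)).symm
  have hFsol : IsIntegralSolution A B b₀ p (δ p) (F p) := by
    intro x hx
    rw [hF p hp p x hpp hx]
    have hint : ∀ t ∈ Set.uIcc (0 : ℝ) 1, F p (x * t) = f p (p, x * t) := by
      intro t ht
      rw [Set.uIcc_of_le zero_le_one] at ht
      refine hF p hp p _ hpp (lt_of_le_of_lt ?_ hx)
      rw [abs_mul, abs_of_nonneg ht.1]
      exact mul_le_of_le_one_right (abs_nonneg _) ht.2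
    obtain ⟨h1, h2⟩ := hsol p hp p hpp x hx
    refine ⟨h1.trans ?_, h2.trans ?_⟩
    · exact intervalIntegral.integral_congr fun t ht => by simp only [hint t ht]
    · congr 2
      exact intervalIntegral.integral_congr fun t ht => by simp only [hint t ht]
  have hF0 : F p 0 = (a₀ p, b₀ p) := by
    obtain ⟨h1, h2⟩ := hFsol 0 (by simpa using hδ p hp)
    simp only [zero_smul, add_zero, zero_mul, intervalIntegral.integral_const, sub_zero,
      one_smul] at h1 h2
    refine Prod.ext ?_ h2
    rw [h1, show F p 0 = ((F p 0).1, b₀ p) from Prod.ext rfl h2, hA₀ p hp]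
  refine ⟨hFan, hF0, hFsol.eventually_hasDerivAt (hδ p hp) ?_ ?_ ?_⟩
  · exact AnalyticAt.fun_comp (g := fun q : P × ℝ => F q.1 q.2) hFan
      (analyticAt_const.prod analyticAt_id)
  · rw [hF0]; exact hA p hp
  · rw [hF0]; exact hB p hp

end GlobalFamily

section FieldEquations

/-- The first-order system for `μ = (r - r_h) ν`, `(r - r_h) k_j = μ S ω_j'`, `S`, `ω_j`
implies the field equations. -/
theorem eym_of_hasDerivAt {N : ℕ} {rh Λ r : ℝ} {ν S : ℝ → ℝ} {k ω : ℕ → ℝ → ℝ} (hr : r ≠ 0)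
    (hω₀ : ω 0 r = 0) (hωN : ω N r = 0) (hν : ν r ≠ 0) (hS : S r ≠ 0)
    (hdν : DifferentiableAt ℝ ν r)
    (hdk : ∀ j ∈ Finset.Icc 1 (N - 1), DifferentiableAt ℝ (k j) r)
    (hω : ∀ᶠ y in 𝓝 r, ∀ j ∈ Finset.Icc 1 (N - 1), HasDerivAt (ω j) (k j y / (ν y * S y)) y)
    (hμ' : HasDerivAt (fun y => (y - rh) * ν y)
      (-(2 * ((r - rh) * ν r) * (∑ j ∈ Finset.Icc 1 (N - 1), (k j r / (ν r * S r)) ^ 2) / r)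
        + (1 - (r - rh) * ν r) / r - Λ * r - 2 * r * pThetaVal N (fun j => ω j r) r) r)
    (hS' : HasDerivAt S
      (2 * S r * (∑ j ∈ Finset.Icc 1 (N - 1), (k j r / (ν r * S r)) ^ 2) / r) r)
    (hk' : ∀ j ∈ Finset.Icc 1 (N - 1), HasDerivAt (fun y => (y - rh) * k j y)
      (-(S r * WVal (fun i => ω i r) j * ω j r / r ^ 2)) r) :
    EYM N Λ (fun y => y * (1 - (y - rh) * ν y - Λ * y ^ 2 / 3) / 2) S ω r := by
  have hG : GF N ω r = ∑ j ∈ Finset.Icc 1 (N - 1), (k j r / (ν r * S r)) ^ 2 :=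
    Finset.sum_congr rfl fun j hj => by rw [(hω.self_of_nhds j hj).deriv]
  rw [← hG] at hμ' hS'
  set G := GF N ω r
  have hmu : muF Λ (fun y => y * (1 - (y - rh) * ν y - Λ * y ^ 2 / 3) / 2) r
      = (r - rh) * ν r := by
    simp only [muF]
    field_simp
    ring
  refine ⟨hω₀, hωN, ?_, ?_, fun j hj => ?_⟩
  · rw [hmu]
    have h : HasDerivAt (fun y => y * (1 - (y - rh) * ν y - Λ * y ^ 2 / 3) / 2) _ r :=
      ((hasDerivAt_id r).fun_mul ((hμ'.const_sub 1).fun_sub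
        (((hasDerivAt_pow 2 r).const_mul Λ).div_const 3))).div_const 2
    refine h.congr_deriv ?_
    simp only [pTheta, id, Nat.cast_ofNat]
    field_simp
    ring
  · convert hS' using 1
    ring
  · have hd : deriv (ω j) =ᶠ[𝓝 r] fun y => k j y / (ν y * S y) := by
      filter_upwards [hω] with y hy
      exact (hy j hj).deriv
    have hdQ : DifferentiableAt ℝ (fun y => k j y / (ν y * S y)) r :=
      (hdk j hj).fun_div (hdν.fun_mul hS'.differentiableAt) (mul_ne_zero hν hS)
    refine ⟨(hω.self_of_nhds j hj).differentiableAt, hdQ.congr_of_eventuallyEq hd, ?_⟩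
    rw [hd.deriv_eq, hd.self_of_nhds, hmu]
    have hprod := (hμ'.mul hS').mul hdQ.hasDerivAt
    have heq : (fun y => (y - rh) * k j y) =ᶠ[𝓝 r]
        ((fun y => (y - rh) * ν y) * S) * fun y => k j y / (ν y * S y) := by
      filter_upwards [hdν.continuousAt.eventually_ne hν,
        hS'.continuousAt.eventually_ne hS] with y h1 h2
      simp only [Pi.mul_apply]
      field_simp
    have key := (hk' j hj).unique (hprod.congr_of_eventuallyEq heq)
    simp only [Pi.mul_apply] at key
    beta_reduce
    simp only [pTheta, WF]
    generalize k j r / (ν r * S r) = Q at key ⊢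
    generalize deriv (fun y => k j y / (ν y * S y)) r = Q' at key ⊢
    field_simp at key
    linear_combination -key

end FieldEquations

section HorizonFields

attribute [local fun_prop] analyticAt_fst analyticAt_snd

variable {E : Type*} [NormedAddCommGroup E] [NormedSpace ℝ E]

theorem extendW_of_mem {N j : ℕ} (hj : j ∈ Finset.Icc 1 (N - 1)) (w : Fin (N - 1) → ℝ) :
    extendW N w j = w ⟨j - 1, by simp at hj; omega⟩ := by
  have := Finset.mem_Icc.1 hj
  exact dif_pos ⟨by omega, by omega⟩

theorem extendW_zero (N : ℕ) (w : Fin (N - 1) → ℝ) : extendW N w 0 = 0 := dif_neg (by simp)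

theorem extendW_self (N : ℕ) (w : Fin (N - 1) → ℝ) : extendW N w N = 0 := dif_neg (by simp)

theorem analyticAt_extendW {N : ℕ} {f : E → Fin (N - 1) → ℝ} {z : E} (hf : AnalyticAt ℝ f z)
    (j : ℕ) : AnalyticAt ℝ (fun y => extendW N (f y) j) z := by
  unfold extendW
  split_ifs with h
  · exact analyticAt_pi_iff.1 hf _
  · exact analyticAt_const

theorem analyticAt_pThetaVal {N : ℕ} {f : E → ℕ → ℝ} {ρ : E → ℝ} {z : E}
    (hf : ∀ j, AnalyticAt ℝ (fun y => f y j) z) (hρ : AnalyticAt ℝ ρ z) (hz : ρ z ≠ 0) :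
    AnalyticAt ℝ (fun y => pThetaVal N (f y) (ρ y)) z := by
  unfold pThetaVal
  refine (analyticAt_const.fun_div (analyticAt_const.fun_mul (hρ.fun_pow 4)) (by positivity)).fun_mul
    (Finset.analyticAt_fun_sum _ fun j _ => ?_)
  have h₁ := hf j
  have h₂ := hf (j - 1)
  fun_prop

theorem analyticAt_WVal {f : E → ℕ → ℝ} {z : E} (hf : ∀ j, AnalyticAt ℝ (fun y => f y j) z)
    (j : ℕ) : AnalyticAt ℝ (fun y => WVal (f y) j) z := by
  unfold WVal
  have h₁ := hf j
  have h₂ := hf (j - 1)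
  have h₃ := hf (j + 1)
  fun_prop

/-- The horizon data `(r_h, Λ, S_h, w)`. -/
abbrev HorizonData (N : ℕ) : Type := ℝ × ℝ × ℝ × (Fin (N - 1) → ℝ)

/-- The value of `ν = μ / (r - r_h)` at the horizon. -/
def horizonSlope (N : ℕ) (p : HorizonData N) : ℝ :=
  1 / p.1 - p.2.1 * p.1 - 2 * p.1 * pThetaVal N (extendW N p.2.2.2) p.1

/-- The expression `G` in terms of `(ν, k)` and `S`. -/
def kineticTerm (N : ℕ) (a : ℝ × (Fin (N - 1) → ℝ)) (S : ℝ) : ℝ :=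
  ∑ j ∈ Finset.Icc 1 (N - 1), (extendW N a.2 j / (a.1 * S)) ^ 2

/-- The right-hand side of the equations for `(x ν, x k)`, with `x = r - r_h`, in the variables
`(x, p, (ν, k), (S, ω))`. -/
def singularField (N : ℕ)
    (z : ℝ × HorizonData N × (ℝ × (Fin (N - 1) → ℝ)) × (ℝ × (Fin (N - 1) → ℝ))) :
    ℝ × (Fin (N - 1) → ℝ) :=
  (-(2 * (z.1 * z.2.2.1.1) * kineticTerm N z.2.2.1 z.2.2.2.1 / (z.2.1.1 + z.1))
      + (1 - z.1 * z.2.2.1.1) / (z.2.1.1 + z.1) - z.2.1.2.1 * (z.2.1.1 + z.1)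
      - 2 * (z.2.1.1 + z.1) * pThetaVal N (extendW N z.2.2.2.2) (z.2.1.1 + z.1),
    fun i => -(z.2.2.2.1 * WVal (extendW N z.2.2.2.2) (i + 1) * z.2.2.2.2 i
      / (z.2.1.1 + z.1) ^ 2))

/-- The right-hand side of the equations for `(S, ω)`. -/
def regularField (N : ℕ)
    (z : ℝ × HorizonData N × (ℝ × (Fin (N - 1) → ℝ)) × (ℝ × (Fin (N - 1) → ℝ))) :
    ℝ × (Fin (N - 1) → ℝ) :=
  (2 * z.2.2.2.1 * kineticTerm N z.2.2.1 z.2.2.2.1 / (z.2.1.1 + z.1),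
    fun i => z.2.2.1.2 i / (z.2.2.1.1 * z.2.2.2.1))

/-- The values of `(ν, k)` at the horizon. -/
def singularInit (N : ℕ) (p : HorizonData N) : ℝ × (Fin (N - 1) → ℝ) :=
  (horizonSlope N p,
    fun i => -(p.2.2.1 * WVal (extendW N p.2.2.2) (i + 1) * p.2.2.2 i / p.1 ^ 2))

/-- The horizon data with a regular non-extremal horizon. -/
def nonextremal (N : ℕ) : Set (HorizonData N) :=
  {p | 0 < p.1 ∧ 0 < p.2.2.1 ∧ 0 < horizonSlope N p}

theorem singularField_zero (N : ℕ) (p : HorizonData N) (a : ℝ × (Fin (N - 1) → ℝ)) :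
    singularField N (0, p, a, p.2.2) = singularInit N p := by
  simp [singularField, singularInit, horizonSlope]

theorem isOpen_nonextremal (N : ℕ) : IsOpen (nonextremal N) := by
  rw [isOpen_iff_mem_nhds]
  rintro p ⟨h₁, h₂, h₃⟩
  have hw : AnalyticAt ℝ (fun q : HorizonData N => q.2.2.2) p := by fun_prop
  have hp : AnalyticAt ℝ (fun q : HorizonData N => pThetaVal N (extendW N q.2.2.2) q.1) p :=
    analyticAt_pThetaVal (analyticAt_extendW hw) (by fun_prop) h₁.ne'
  have hc : ContinuousAt (horizonSlope N) p := by
    have : p.1 ≠ 0 := h₁.ne'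
    have := hp.continuousAt
    unfold horizonSlope
    fun_prop (disch := assumption)
  have c₁ : ContinuousAt (fun q : HorizonData N => q.1) p := by fun_prop
  have c₂ : ContinuousAt (fun q : HorizonData N => q.2.2.1) p := by fun_prop
  filter_upwards [c₁.eventually_const_lt h₁, c₂.eventually_const_lt h₂,
    hc.eventually_const_lt h₃] with q g₁ g₂ g₃ using ⟨g₁, g₂, g₃⟩

theorem analyticAt_kineticTerm {N : ℕ} {a : E → ℝ × (Fin (N - 1) → ℝ)} {S : E → ℝ} {z : E}
    (ha : AnalyticAt ℝ a z) (hS : AnalyticAt ℝ S z) (ha₀ : (a z).1 ≠ 0) (hS₀ : S z ≠ 0) :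
    AnalyticAt ℝ (fun y => kineticTerm N (a y) (S y)) z := by
  unfold kineticTerm
  refine Finset.analyticAt_fun_sum _ fun j _ => ?_
  have h : AnalyticAt ℝ (fun y => (a y).2) z := by fun_prop
  exact ((analyticAt_extendW h j).fun_div (by fun_prop) (mul_ne_zero ha₀ hS₀)).fun_pow 2

variable {N : ℕ}
  {z : ℝ × HorizonData N × (ℝ × (Fin (N - 1) → ℝ)) × (ℝ × (Fin (N - 1) → ℝ))}

theorem analyticAt_singularField (hr : z.2.1.1 + z.1 ≠ 0) (hν : z.2.2.1.1 ≠ 0)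
    (hS : z.2.2.2.1 ≠ 0) : AnalyticAt ℝ (singularField N) z := by
  have hw : AnalyticAt ℝ (fun z : ℝ × HorizonData N × (ℝ × (Fin (N - 1) → ℝ)) ×
      (ℝ × (Fin (N - 1) → ℝ)) => z.2.2.2.2) z := by fun_prop
  have hG : AnalyticAt ℝ (fun z : ℝ × HorizonData N × (ℝ × (Fin (N - 1) → ℝ)) ×
      (ℝ × (Fin (N - 1) → ℝ)) => kineticTerm N z.2.2.1 z.2.2.2.1) z :=
    analyticAt_kineticTerm (by fun_prop) (by fun_prop) hν hS
  have hp : AnalyticAt ℝ (fun z : ℝ × HorizonData N × (ℝ × (Fin (N - 1) → ℝ)) ×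
      (ℝ × (Fin (N - 1) → ℝ)) => pThetaVal N (extendW N z.2.2.2.2) (z.2.1.1 + z.1)) z :=
    analyticAt_pThetaVal (analyticAt_extendW hw) (by fun_prop) hr
  unfold singularField
  refine AnalyticAt.prod (by fun_prop (disch := assumption)) (analyticAt_pi_iff.2 fun i => ?_)
  have hW := analyticAt_WVal (analyticAt_extendW hw) (i + 1)
  have hi := analyticAt_pi_iff.1 hw i
  have : (z.2.1.1 + z.1) ^ 2 ≠ 0 := pow_ne_zero 2 hr
  fun_prop (disch := assumption)

theorem analyticAt_regularField (hr : z.2.1.1 + z.1 ≠ 0) (hν : z.2.2.1.1 ≠ 0)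
    (hS : z.2.2.2.1 ≠ 0) : AnalyticAt ℝ (regularField N) z := by
  have hk : AnalyticAt ℝ (fun z : ℝ × HorizonData N × (ℝ × (Fin (N - 1) → ℝ)) ×
      (ℝ × (Fin (N - 1) → ℝ)) => z.2.2.1.2) z := by fun_prop
  have hG : AnalyticAt ℝ (fun z : ℝ × HorizonData N × (ℝ × (Fin (N - 1) → ℝ)) ×
      (ℝ × (Fin (N - 1) → ℝ)) => kineticTerm N z.2.2.1 z.2.2.2.1) z :=
    analyticAt_kineticTerm (by fun_prop) (by fun_prop) hν hS
  unfold regularField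
  refine AnalyticAt.prod (by fun_prop (disch := assumption)) (analyticAt_pi_iff.2 fun i => ?_)
  have hi := analyticAt_pi_iff.1 hk i
  have := mul_ne_zero hν hS
  fun_prop (disch := assumption)

theorem exists_horizon_family (N : ℕ) :
    ∃ F : HorizonData N → ℝ → (ℝ × (Fin (N - 1) → ℝ)) × (ℝ × (Fin (N - 1) → ℝ)),
      ∀ p ∈ nonextremal N, AnalyticAt ℝ (fun q : HorizonData N × ℝ => F q.1 q.2) (p, 0) ∧
        F p 0 = (singularInit N p, p.2.2) ∧
        ∀ᶠ x in 𝓝 (0 : ℝ),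
          HasDerivAt (fun x => x • (F p x).1) (singularField N (x, p, F p x)) x ∧
          HasDerivAt (fun x => (F p x).2) (regularField N (x, p, F p x)) x := by
  have hne : ∀ p ∈ nonextremal N, p.1 + 0 ≠ 0 := fun p hp => by simpa using hp.1.ne'
  exact exists_analytic_family (isOpen_nonextremal N) (fun p _ a => singularField_zero N p a)
    (fun p hp => analyticAt_singularField (hne p hp) hp.2.2.ne' hp.2.1.ne')
    (fun p hp => analyticAt_regularField (hne p hp) hp.2.2.ne' hp.2.1.ne')
    (fun p _ => by fun_prop)

/-- A solution of the first-order system in `x = r - r_h` gives a solution of the field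
equations at `r = r_h + x`. -/
theorem eym_of_firstOrder {p : HorizonData N} {r : ℝ}
    {f : ℝ → (ℝ × (Fin (N - 1) → ℝ)) × (ℝ × (Fin (N - 1) → ℝ))}
    (hr : r ≠ 0) (hν : (f (r - p.1)).1.1 ≠ 0) (hS : (f (r - p.1)).2.1 ≠ 0)
    (hf : DifferentiableAt ℝ f (r - p.1))
    (h₁ : HasDerivAt (fun x => x • (f x).1) (singularField N (r - p.1, p, f (r - p.1))) (r - p.1))
    (h₂ : ∀ᶠ x in 𝓝 (r - p.1),
      HasDerivAt (fun x => (f x).2) (regularField N (x, p, f x)) x) :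
    EYM N p.2.1
      (fun y => y * (1 - (y - p.1) * (f (y - p.1)).1.1 - p.2.1 * y ^ 2 / 3) / 2)
      (fun y => (f (y - p.1)).2.1) (fun j y => extendW N (f (y - p.1)).2.2 j) r := by
  have hsub : Tendsto (fun y => y - p.1) (𝓝 r) (𝓝 (r - p.1)) :=
    (continuous_sub_right p.1).tendsto r
  have hdf : DifferentiableAt ℝ (fun y => f (y - p.1)) r := by
    simpa only [differentiableAt_comp_sub_const] using hf
  refine eym_of_hasDerivAt (ν := fun y => (f (y - p.1)).1.1)
    (k := fun j y => extendW N (f (y - p.1)).1.2 j) hr (extendW_zero N _) (extendW_self N _) hν hS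
    (by fun_prop) (fun j hj => ?_) ?_ ?_ ?_ (fun j hj => ?_)
  · simp only [extendW_of_mem hj]
    have : DifferentiableAt ℝ (fun y => (f (y - p.1)).1.2) r := by fun_prop
    exact differentiableAt_pi.1 this _
  · filter_upwards [hsub.eventually h₂] with y hy j hj
    simp only [extendW_of_mem hj]
    exact HasDerivAt.comp_sub_const y p.1 (hasDerivAt_pi.1 hy.snd _)
  · have h := HasDerivAt.comp_sub_const r p.1 h₁.fst
    simpa [singularField, kineticTerm] using h
  · have h := HasDerivAt.comp_sub_const r p.1 h₂.self_of_nhds.fst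
    simpa [regularField, kineticTerm] using h
  · have hj' := Finset.mem_Icc.1 hj
    have h := HasDerivAt.comp_sub_const r p.1
      (hasDerivAt_pi.1 h₁.snd ⟨j - 1, by omega⟩)
    simp only [extendW_of_mem hj]
    simpa [singularField, Nat.sub_add_cancel hj'.1] using h

/-- The non-extremality condition says that `ν` is positive at the horizon. -/
theorem horizonSlope_pos {rh Λ Sh : ℝ} {w : Fin (N - 1) → ℝ} (hrh : 0 < rh)
    (h : 2 * rh ^ 2 * pThetaVal N (extendW N w) rh < 1 - Λ * rh ^ 2) :
    0 < horizonSlope N (rh, Λ, Sh, w) := by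
  have : horizonSlope N (rh, Λ, Sh, w)
      = (1 - Λ * rh ^ 2 - 2 * rh ^ 2 * pThetaVal N (extendW N w) rh) / rh := by
    simp only [horizonSlope]
    field_simp
  rw [this]
  exact div_pos (by linarith) hrh

/-- A solution of the first-order system near `x = 0` solves the field equations on a right
neighbourhood of the horizon. -/
theorem exists_eym_Ico {p : HorizonData N} (hp : p ∈ nonextremal N)
    {f : ℝ → (ℝ × (Fin (N - 1) → ℝ)) × (ℝ × (Fin (N - 1) → ℝ))} (hf : AnalyticAt ℝ f 0)
    (hf₀ : f 0 = (singularInit N p, p.2.2))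
    (hf' : ∀ᶠ x in 𝓝 (0 : ℝ),
      HasDerivAt (fun x => x • (f x).1) (singularField N (x, p, f x)) x ∧
      HasDerivAt (fun x => (f x).2) (regularField N (x, p, f x)) x) :
    ∃ ε > 0, ∀ r ∈ Set.Ico p.1 (p.1 + ε), EYM N p.2.1
      (fun y => y * (1 - (y - p.1) * (f (y - p.1)).1.1 - p.2.1 * y ^ 2 / 3) / 2)
      (fun y => (f (y - p.1)).2.1) (fun j y => extendW N (f (y - p.1)).2.2 j) r := by
  have hν : (f 0).1.1 ≠ 0 := by rw [hf₀]; exact hp.2.2.ne'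
  have hS : (f 0).2.1 ≠ 0 := by rw [hf₀]; exact hp.2.1.ne'
  have hc := hf.continuousAt
  have h := (hc.fst.fst.eventually_ne hν).and ((hc.snd.fst.eventually_ne hS).and
    (hf.eventually_analyticAt.and hf'.eventually_nhds))
  obtain ⟨ε, hε, h⟩ := Metric.eventually_nhds_iff.1 h
  refine ⟨ε, hε, fun r hr => ?_⟩
  have hdist : dist (r - p.1) 0 < ε := by
    rw [Real.dist_0_eq_abs, abs_of_nonneg (by linarith [hr.1])]
    linarith [hr.2]
  obtain ⟨h₁, h₂, h₃, h₄⟩ := h hdist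
  exact eym_of_firstOrder (hp.1.trans_le hr.1).ne' h₁ h₂ h₃.differentiableAt
    h₄.self_of_nhds.1 (h₄.mono fun _ hx => hx.2)

end HorizonFields

end HorizonODE

attribute [local fun_prop] analyticAt_fst analyticAt_snd

/-- **Local existence near the event horizon.** For every r_h > 0, Λ < 0, S_h > 0 and
horizon values (w_1, …, w_{N−1}) satisfying the non-extremality condition
2r_h²p_θ(r_h) < 1 − Λr_h², there exist ε > 0 and a solution of the su(N) EYM equations
on [r_h, r_h + ε) with m(r_h) = (r_h − Λr_h³/3)/2, S(r_h) = S_h, ω_j(r_h) = w_j and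
ω_j′(r_h) = −W_j(r_h)w_j/(2m(r_h) − 2r_h³p_θ(r_h) − (2Λ/3)r_h³), depending analytically
on (r, r_h, Λ, w, S_h): an (N+2)-parameter family for fixed Λ. -/
theorem local_existence_horizon (N : ℕ) (hN : 2 ≤ N) :
    ∃ (ε : ℝ × ℝ × ℝ × (Fin (N - 1) → ℝ) → ℝ)
      (mF SF : ℝ × ℝ × ℝ × (Fin (N - 1) → ℝ) → ℝ → ℝ)
      (ωF : ℝ × ℝ × ℝ × (Fin (N - 1) → ℝ) → ℕ → ℝ → ℝ),
      ∀ (rh Λ Sh : ℝ) (w : Fin (N - 1) → ℝ),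
        0 < rh → Λ < 0 → 0 < Sh →
        2 * rh ^ 2 * pThetaVal N (extendW N w) rh < 1 - Λ * rh ^ 2 →
        0 < ε (rh, Λ, Sh, w) ∧
        (∀ r ∈ Set.Ico rh (rh + ε (rh, Λ, Sh, w)),
          EYM N Λ (mF (rh, Λ, Sh, w)) (SF (rh, Λ, Sh, w)) (ωF (rh, Λ, Sh, w)) r) ∧
        mF (rh, Λ, Sh, w) rh = (rh - Λ * rh ^ 3 / 3) / 2 ∧
        SF (rh, Λ, Sh, w) rh = Sh ∧
        (∀ j ∈ Finset.Icc 1 (N - 1), ωF (rh, Λ, Sh, w) j rh = extendW N w j) ∧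
        (∀ j ∈ Finset.Icc 1 (N - 1),
          deriv (ωF (rh, Λ, Sh, w) j) rh
            = -(WVal (extendW N w) j * extendW N w j)
              / (2 * mF (rh, Λ, Sh, w) rh - 2 * rh ^ 3 * pThetaVal N (extendW N w) rh
                  - 2 * Λ * rh ^ 3 / 3)) ∧
        AnalyticAt ℝ
          (fun q : (ℝ × ℝ × ℝ × (Fin (N - 1) → ℝ)) × ℝ => mF q.1 (q.1.1 + q.2))
          ((rh, Λ, Sh, w), 0) ∧
        AnalyticAt ℝ
          (fun q : (ℝ × ℝ × ℝ × (Fin (N - 1) → ℝ)) × ℝ => SF q.1 (q.1.1 + q.2))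
          ((rh, Λ, Sh, w), 0) ∧
        ∀ j ∈ Finset.Icc 1 (N - 1),
          AnalyticAt ℝ
            (fun q : (ℝ × ℝ × ℝ × (Fin (N - 1) → ℝ)) × ℝ => ωF q.1 j (q.1.1 + q.2))
            ((rh, Λ, Sh, w), 0) := by
  obtain ⟨F, hF⟩ := HorizonODE.exists_horizon_family N
  have hε : ∀ p, ∃ ε : ℝ, p ∈ HorizonODE.nonextremal N → 0 < ε ∧
      ∀ r ∈ Set.Ico p.1 (p.1 + ε), EYM N p.2.1
        (fun y => y * (1 - (y - p.1) * (F p (y - p.1)).1.1 - p.2.1 * y ^ 2 / 3) / 2)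
        (fun y => (F p (y - p.1)).2.1) (fun j y => extendW N (F p (y - p.1)).2.2 j) r := by
    intro p
    by_cases hp : p ∈ HorizonODE.nonextremal N
    · obtain ⟨hA, h₀, h'⟩ := hF p hp
      obtain ⟨ε, hε, h⟩ := HorizonODE.exists_eym_Ico hp hA.along_snd h₀ h'
      exact ⟨ε, fun _ => ⟨hε, h⟩⟩
    · exact ⟨0, fun h => absurd h hp⟩
  choose ε hε using hε
  refine ⟨ε, fun p y => y * (1 - (y - p.1) * (F p (y - p.1)).1.1 - p.2.1 * y ^ 2 / 3) / 2,
    fun p y => (F p (y - p.1)).2.1, fun p j y => extendW N (F p (y - p.1)).2.2 j,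
    fun rh Λ Sh w hrh hΛ hSh hne => ?_⟩
  have hslope := HorizonODE.horizonSlope_pos (Sh := Sh) hrh hne
  obtain ⟨hA, h₀, h'⟩ := hF (rh, Λ, Sh, w) ⟨hrh, hSh, hslope⟩
  obtain ⟨hε₀, hE⟩ := hε (rh, Λ, Sh, w) ⟨hrh, hSh, hslope⟩
  have hν : AnalyticAt ℝ (fun q : HorizonODE.HorizonData N × ℝ => (F q.1 q.2).1.1)
      ((rh, Λ, Sh, w), 0) := (analyticAt_fst.comp analyticAt_fst).comp hA
  have hS : AnalyticAt ℝ (fun q : HorizonODE.HorizonData N × ℝ => (F q.1 q.2).2.1)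
      ((rh, Λ, Sh, w), 0) := (analyticAt_fst.comp analyticAt_snd).comp hA
  have hω : AnalyticAt ℝ (fun q : HorizonODE.HorizonData N × ℝ => (F q.1 q.2).2.2)
      ((rh, Λ, Sh, w), 0) := (analyticAt_snd.comp analyticAt_snd).comp hA
  refine ⟨hε₀, hE, ?_, ?_, fun j hj => ?_, fun j hj => ?_, ?_, ?_, fun j hj => ?_⟩
  · simp only [sub_self, zero_mul, sub_zero]
    ring
  · simp [h₀]
  · simp [h₀]
  · have hj' := Finset.mem_Icc.1 hj
    have h := (hasDerivAt_pi.1 h'.self_of_nhds.2.snd ⟨j - 1, by omega⟩)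
    rw [← sub_self rh] at h
    simp only [HorizonODE.extendW_of_mem hj]
    rw [(HasDerivAt.comp_sub_const rh rh h).deriv]
    have hd : 2 * (rh * (1 - (rh - rh) * (F (rh, Λ, Sh, w) (rh - rh)).1.1 - Λ * rh ^ 2 / 3) / 2)
        - 2 * rh ^ 3 * pThetaVal N (extendW N w) rh - 2 * Λ * rh ^ 3 / 3
        = rh ^ 2 * HorizonODE.horizonSlope N (rh, Λ, Sh, w) := by
      simp only [HorizonODE.horizonSlope]
      field_simp
      ring
    rw [hd]
    simp only [sub_self, h₀, HorizonODE.regularField, HorizonODE.singularInit,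
      Nat.sub_add_cancel hj'.1]
    field_simp
  · simp only [add_sub_cancel_left]
    fun_prop
  · simpa only [add_sub_cancel_left] using hS
  · simpa only [add_sub_cancel_left] using HorizonODE.analyticAt_extendW hω j
end
end

section
/- For every Λ < 0, every M ∈ ℝ, every (ω_{1,∞}, …, ω_{N−1,∞}) ∈ ℝ^{N−1} and every (c_1, …, c_{N−1}) ∈ ℝ^{N−1}, there exist R > 0 and a solution (m, S, ω_1, …, ω_{N−1}) of the su(N) EYM field equations on (R, ∞) such that m(r) = M + O(1/r), S(r) = 1 + O(1/r), ω_j(r) = ω_{j,∞} + O(1/r) and r²ω_j′(r) = c_j + O(1/r) as r → ∞, with all field variables analytic as functions of 1/r at 1/r = 0 and depending analytically on the 2N parameters (Λ, M, ω_{1,∞}, …, ω_{N−1,∞}, c_1, …, c_{N−1}). In particular, no constraint is imposed on the asymptotic values ω_{j,∞} of the gauge field functions. -/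
open Filter Asymptotics Topology

noncomputable section

section PolynomialFlow

variable {ι : Type*}

/-- Continuous real functions on `[-2, 2]`, as a commutative Banach algebra. -/
abbrev PathAlg : Type := C(Set.Icc (-2 : ℝ) 2, ℝ)

theorem neg_two_le_two : (-2 : ℝ) ≤ 2 := by norm_num

/-- The continuous extension of a path to the whole line. -/
def PathAlg.ext (f : PathAlg) : ℝ → ℝ := Set.IccExtend neg_two_le_two f

theorem PathAlg.continuous_ext (f : PathAlg) : Continuous f.ext :=
  f.continuous.Icc_extend'

theorem PathAlg.ext_of_mem (f : PathAlg) {t : ℝ} (ht : t ∈ Set.Icc (-2 : ℝ) 2) :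
    f.ext t = f ⟨t, ht⟩ := Set.IccExtend_of_mem _ _ ht

theorem PathAlg.hasDerivAt_integral (f : PathAlg) (t : ℝ) :
    HasDerivAt (fun t => ∫ s in (0 : ℝ)..t, f.ext s) (f.ext t) t :=
  intervalIntegral.integral_hasDerivAt_right (f.continuous_ext.intervalIntegrable _ _)
    (f.continuous_ext.stronglyMeasurableAtFilter _ _) f.continuous_ext.continuousAt

/-- The primitive vanishing at `0`, as a continuous linear operator on paths. -/
def PathAlg.primitive : PathAlg →L[ℝ] PathAlg :=
  LinearMap.mkContinuous
    { toFun := fun f => ⟨fun t => ∫ s in (0 : ℝ)..t, f.ext s,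
        (continuous_iff_continuousAt.2 fun t => (f.hasDerivAt_integral t).continuousAt).comp
          continuous_subtype_val⟩
      map_add' := fun f g => by
        ext t
        exact intervalIntegral.integral_add (f.continuous_ext.intervalIntegrable _ _)
          (g.continuous_ext.intervalIntegrable _ _)
      map_smul' := fun c f => by
        ext t
        exact intervalIntegral.integral_const_mul c _ }
    2 (fun f => by
      refine (ContinuousMap.norm_le _ (by positivity)).2 fun t => ?_
      have h := intervalIntegral.norm_integral_le_of_norm_le_const (a := 0) (b := (t : ℝ))
        (f := f.ext) (C := ‖f‖) fun s _ => f.norm_coe_le_norm _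
      have ht : |(t : ℝ) - 0| ≤ 2 := by
        rw [sub_zero]; exact abs_le.2 t.2
      calc _ ≤ ‖f‖ * |(t : ℝ) - 0| := h
        _ ≤ 2 * ‖f‖ := by nlinarith [norm_nonneg f])

theorem PathAlg.primitive_apply (f : PathAlg) (t : Set.Icc (-2 : ℝ) 2) :
    PathAlg.primitive f t = ∫ s in (0 : ℝ)..t, f.ext s := rfl

/-- The vector field on `ι → ℝ` with polynomial components `F`. -/
def polyField (F : ι → MvPolynomial ι ℝ) (y : ι → ℝ) : ι → ℝ :=
  fun i => MvPolynomial.eval y (F i)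

/-- `u` is an integral curve of the polynomial field `F` on `(-a, a)` starting at `p`. -/
structure IsPolySolution (F : ι → MvPolynomial ι ℝ) (p : ι → ℝ) (u : ℝ → ι → ℝ) (a : ℝ) :
    Prop where
  initial : u 0 = p
  hasDerivAt : ∀ s ∈ Set.Ioo (-a) a, HasDerivAt u (polyField F (u s)) s

open Classical in
/-- The local flow of the polynomial field `F`; the junk value is the starting point. -/
def polyFlow (F : ι → MvPolynomial ι ℝ) (p : ι → ℝ) (x : ℝ) : ι → ℝ :=
  if h : ∃ u a, |x| < a ∧ IsPolySolution F p u a then h.choose x else p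

theorem polyFlow_zero (F : ι → MvPolynomial ι ℝ) (p : ι → ℝ) : polyFlow F p 0 = p := by
  unfold polyFlow
  split_ifs with h
  · exact h.choose_spec.choose_spec.2.initial
  · rfl

/-- The rescaled Picard operator: integral curves with time rescaled by `ε` are the solutions
`z` of `picardMap F (ε, z) = (ε, p)`. -/
def picardMap (F : ι → MvPolynomial ι ℝ) (q : ℝ × (ι → PathAlg)) : ℝ × (ι → PathAlg) :=
  (q.1, fun i => q.2 i - q.1 • PathAlg.primitive (MvPolynomial.aeval q.2 (F i)))

theorem isPolySolution_of_picardMap_eq {F : ι → MvPolynomial ι ℝ} {p : ι → ℝ} {ε : ℝ}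
    {z : ι → PathAlg} (hε : ε ≠ 0)
    (hz : picardMap F (ε, z) = (ε, fun i => ContinuousMap.const _ (p i))) :
    ∃ u, IsPolySolution F p u (2 * |ε|) ∧ ∀ i, u ε i = z i ⟨1, by norm_num, by norm_num⟩ := by
  set u : ℝ → ι → ℝ := fun s i =>
    p i + ε * ∫ t in (0 : ℝ)..(s / ε), (MvPolynomial.aeval z (F i) : PathAlg).ext t with hu
  have huz : ∀ s (hs : s / ε ∈ Set.Icc (-2 : ℝ) 2), ∀ i, u s i = z i ⟨s / ε, hs⟩ := by
    intro s hs i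
    have h1 := congrArg (fun q : ℝ × (ι → PathAlg) => q.2 i ⟨s / ε, hs⟩) hz
    simp only [picardMap, ContinuousMap.sub_apply, ContinuousMap.smul_apply,
      PathAlg.primitive_apply, ContinuousMap.const_apply, smul_eq_mul] at h1
    simp only [hu]
    linarith
  refine ⟨u, ⟨by ext i; simp [hu], fun s hs => hasDerivAt_pi.2 fun i => ?_⟩, fun i => ?_⟩
  · have hmem : s / ε ∈ Set.Icc (-2 : ℝ) 2 := by
      refine abs_le.1 ?_
      rw [abs_div, div_le_iff₀ (abs_pos.2 hε)]
      exact (abs_lt.2 hs).le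
    have hd := (((MvPolynomial.aeval z (F i) : PathAlg).hasDerivAt_integral (s / ε)).comp s
      ((hasDerivAt_id s).div_const ε)).const_mul ε |>.const_add (p i)
    refine hd.congr_deriv ?_
    have hus : u s = fun j => z j ⟨s / ε, hmem⟩ := funext (huz s hmem)
    rw [PathAlg.ext_of_mem _ hmem, polyField, hus]
    have hev : (MvPolynomial.aeval z (F i) : PathAlg) ⟨s / ε, hmem⟩ =
        MvPolynomial.aeval (fun j => z j ⟨s / ε, hmem⟩) (F i) :=
      (MvPolynomial.comp_aeval_apply z (ContinuousMap.evalAlgHom ℝ ℝ ⟨s / ε, hmem⟩) (F i))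
    rw [hev, MvPolynomial.aeval_eq_eval]
    field_simp
  · have h1 : ε / ε = 1 := div_self hε
    have := huz ε (by rw [h1]; norm_num) i
    simpa only [h1] using this

variable [Fintype ι]

theorem contDiff_polyField (F : ι → MvPolynomial ι ℝ) : ContDiff ℝ 1 (polyField F) :=
  contDiff_pi.2 fun i =>
    (contDiffOn_univ.1 (AnalyticOnNhd.eval_mvPolynomial (F i)).contDiffOn_of_completeSpace)

theorem IsPolySolution.unique {F : ι → MvPolynomial ι ℝ} {p : ι → ℝ} {u v : ℝ → ι → ℝ}
    {a b x : ℝ} (hu : IsPolySolution F p u a) (hv : IsPolySolution F p v b)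
    (hxa : |x| < a) (hxb : |x| < b) : u x = v x := by
  obtain ⟨c, hxc, hc⟩ := exists_between (lt_min hxa hxb)
  have hca : c < a := hc.trans_le (min_le_left _ _)
  have hcb : c < b := hc.trans_le (min_le_right _ _)
  have hc0 : 0 < c := (abs_nonneg x).trans_lt hxc
  have hua : ∀ s ∈ Set.Icc (-c) c, HasDerivAt u (polyField F (u s)) s := fun s hs =>
    hu.hasDerivAt s ⟨by linarith [hs.1], by linarith [hs.2]⟩
  have hvb : ∀ s ∈ Set.Icc (-c) c, HasDerivAt v (polyField F (v s)) s := fun s hs =>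
    hv.hasDerivAt s ⟨by linarith [hs.1], by linarith [hs.2]⟩
  have hcu : ContinuousOn u (Set.Icc (-c) c) := HasDerivAt.continuousOn hua
  have hcv : ContinuousOn v (Set.Icc (-c) c) := HasDerivAt.continuousOn hvb
  obtain ⟨B, hB⟩ := ((isCompact_Icc.image_of_continuousOn hcu).union
    (isCompact_Icc.image_of_continuousOn hcv)).isBounded.subset_closedBall 0
  obtain ⟨K, hK⟩ := (contDiff_polyField F).contDiffOn.exists_lipschitzOnWith one_ne_zero
    (convex_closedBall (0 : ι → ℝ) B) (isCompact_closedBall _ _)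
  have key := ODE_solution_unique_of_mem_Ioo (v := fun _ => polyField F)
    (s := fun _ => Metric.closedBall 0 B) (K := K) (a := -c) (b := c) (t₀ := 0) (f := u) (g := v)
    (fun _ _ => hK) ⟨by linarith, hc0⟩
    (fun t ht => ⟨hua t (Set.Ioo_subset_Icc_self ht),
      hB (Or.inl ⟨t, Set.Ioo_subset_Icc_self ht, rfl⟩)⟩)
    (fun t ht => ⟨hvb t (Set.Ioo_subset_Icc_self ht),
      hB (Or.inr ⟨t, Set.Ioo_subset_Icc_self ht, rfl⟩)⟩)
    (by rw [hu.initial, hv.initial])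
  exact key (abs_lt.1 hxc)

theorem IsPolySolution.polyFlow_eq {F : ι → MvPolynomial ι ℝ} {p : ι → ℝ} {u : ℝ → ι → ℝ}
    {a x : ℝ} (hu : IsPolySolution F p u a) (hx : |x| < a) : polyFlow F p x = u x := by
  have h : ∃ u a, |x| < a ∧ IsPolySolution F p u a := ⟨u, a, hx, hu⟩
  rw [polyFlow, dif_pos h]
  exact h.choose_spec.choose_spec.2.unique hu h.choose_spec.choose_spec.1 hx

theorem analyticAt_picardMap (F : ι → MvPolynomial ι ℝ) (q : ℝ × (ι → PathAlg)) :
    AnalyticAt ℝ (picardMap F) q := by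
  have hz : ∀ i, AnalyticAt ℝ (fun q : ℝ × (ι → PathAlg) => q.2 i) q := fun i =>
    ((ContinuousLinearMap.proj (R := ℝ) (φ := fun _ : ι => PathAlg) i).analyticAt _).comp
      analyticAt_snd
  refine analyticAt_fst.prod (AnalyticAt.pi fun i => (hz i).sub (analyticAt_fst.smul ?_))
  exact (PathAlg.primitive.analyticAt _).comp (AnalyticAt.aeval_mvPolynomial hz (F i))

/-- The shear `(e, z) ↦ (e, z - e • w)` as a continuous linear equivalence. -/
def shearEquiv {Z : Type*} [NormedAddCommGroup Z] [NormedSpace ℝ Z] (w : Z) :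
    (ℝ × Z) ≃L[ℝ] (ℝ × Z) :=
  ContinuousLinearEquiv.equivOfInverse
    ((ContinuousLinearMap.fst ℝ ℝ Z).prod
      (ContinuousLinearMap.snd ℝ ℝ Z - (ContinuousLinearMap.fst ℝ ℝ Z).smulRight w))
    ((ContinuousLinearMap.fst ℝ ℝ Z).prod
      (ContinuousLinearMap.snd ℝ ℝ Z + (ContinuousLinearMap.fst ℝ ℝ Z).smulRight w))
    (fun q => by simp) (fun q => by simp)

theorem hasFDerivAt_picardMap (F : ι → MvPolynomial ι ℝ) (z : ι → PathAlg) :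
    HasFDerivAt (picardMap F) (shearEquiv (fun i => PathAlg.primitive
      (MvPolynomial.aeval z (F i))) : (ℝ × (ι → PathAlg)) →L[ℝ] (ℝ × (ι → PathAlg))) (0, z) := by
  refine hasFDerivAt_fst.prodMk (hasFDerivAt_snd.sub ?_)
  have hd : DifferentiableAt ℝ (fun q : ℝ × (ι → PathAlg) => fun i =>
      PathAlg.primitive (MvPolynomial.aeval q.2 (F i))) (0, z) := by
    refine (AnalyticAt.pi fun i => (PathAlg.primitive.analyticAt _).comp
      (AnalyticAt.aeval_mvPolynomial (fun j => ?_) (F i))).differentiableAt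
    exact ((ContinuousLinearMap.proj (R := ℝ) (φ := fun _ : ι => PathAlg) j).analyticAt _).comp
      analyticAt_snd
  have := hasFDerivAt_fst.smul hd.hasFDerivAt (x := ((0 : ℝ), z))
  refine this.congr_fderiv ?_
  ext <;> simp

theorem exists_analyticAt_picardMap_inverse (F : ι → MvPolynomial ι ℝ) (p : ι → ℝ) :
    ∃ z : (ι → ℝ) × ℝ → ι → PathAlg, AnalyticAt ℝ z (p, 0) ∧
      ∀ᶠ q in 𝓝 (p, (0 : ℝ)),
        picardMap F (q.2, z q) = (q.2, fun i => ContinuousMap.const _ (q.1 i)) := by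
  set z₀ : ι → PathAlg := fun i => ContinuousMap.const _ (p i)
  set e := shearEquiv (fun i => PathAlg.primitive (MvPolynomial.aeval z₀ (F i)))
  have hder := hasFDerivAt_picardMap F z₀
  have hstrict : HasStrictFDerivAt (picardMap F)
      (e : (ℝ × (ι → PathAlg)) →L[ℝ] (ℝ × (ι → PathAlg))) (0, z₀) := by
    have h := (analyticAt_picardMap F (0, z₀)).hasStrictFDerivAt
    rwa [hder.fderiv] at h
  set H := hstrict.toOpenPartialHomeomorph (picardMap F)
  have hsrc : ((0 : ℝ), z₀) ∈ H.source := hstrict.mem_toOpenPartialHomeomorph_source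
  have hH0 : picardMap F (0, z₀) = (0, z₀) := by simp [picardMap]
  have hsymm : AnalyticAt ℝ H.symm (0, z₀) := by
    obtain ⟨P, hP⟩ := analyticAt_picardMap F (0, z₀)
    have hPe : P 1 = (continuousMultilinearCurryFin1 ℝ (ℝ × (ι → PathAlg))
        (ℝ × (ι → PathAlg))).symm e := by
      rw [← hder.unique hP.hasFDerivAt |>.symm]
      simp
    have := (H.hasFPowerSeriesAt_symm hsrc hP hPe).analyticAt
    rwa [hstrict.toOpenPartialHomeomorph_coe, hH0] at this
  set κ : (ι → ℝ) × ℝ → ℝ × (ι → PathAlg) :=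
    fun q => (q.2, fun i => ContinuousMap.const _ (q.1 i))
  have hκa : AnalyticAt ℝ κ (p, 0) := by
    refine analyticAt_snd.prod (AnalyticAt.pi fun i => ?_)
    have h1 : AnalyticAt ℝ (fun q : (ι → ℝ) × ℝ => q.1 i) (p, 0) :=
      ((ContinuousLinearMap.proj (R := ℝ) (φ := fun _ : ι => ℝ) i).analyticAt _).comp
        analyticAt_fst
    exact ((Algebra.linearMap ℝ PathAlg).toContinuousLinearMap.analyticAt _).comp h1
  have hκ0 : κ (p, 0) = (0, z₀) := rfl
  have hin : AnalyticAt ℝ (fun q => H.symm (κ q)) (p, 0) :=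
    AnalyticAt.comp (g := H.symm) (hκ0 ▸ hsymm) hκa
  refine ⟨fun q => (H.symm (κ q)).2, analyticAt_snd.comp hin, ?_⟩
  have htgt : H.target ∈ 𝓝 (κ (p, 0)) := by
    refine H.open_target.mem_nhds ?_
    have := H.map_source hsrc
    rwa [hstrict.toOpenPartialHomeomorph_coe, hH0] at this
  filter_upwards [hκa.continuousAt.preimage_mem_nhds htgt] with q hq
  have h1 : picardMap F (H.symm (κ q)) = κ q := by
    have := H.right_inv hq
    rwa [hstrict.toOpenPartialHomeomorph_coe] at this
  have h2 : (H.symm (κ q)).1 = q.2 := congrArg Prod.fst h1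
  have h3 : (q.2, (H.symm (κ q)).2) = H.symm (κ q) := Prod.ext h2.symm rfl
  rw [h3]
  exact h1

theorem analyticAt_polyFlow (F : ι → MvPolynomial ι ℝ) (p : ι → ℝ) :
    AnalyticAt ℝ (fun q : (ι → ℝ) × ℝ => polyFlow F q.1 q.2) (p, 0) := by
  obtain ⟨z, hza, hz⟩ := exists_analyticAt_picardMap_inverse F p
  have hone : (1 : ℝ) ∈ Set.Icc (-2 : ℝ) 2 := by norm_num
  have hev : AnalyticAt ℝ (fun q => fun i => z q i ⟨1, hone⟩) (p, 0) := by
    refine AnalyticAt.pi fun i => ?_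
    exact ((ContinuousMap.evalCLM ℝ (⟨1, hone⟩ : Set.Icc (-2 : ℝ) 2)).analyticAt _).comp
      (((ContinuousLinearMap.proj (R := ℝ) (φ := fun _ : ι => PathAlg) i).analyticAt _).comp hza)
  refine hev.congr ?_
  filter_upwards [hz] with q hq
  obtain ⟨y, ε⟩ := q
  by_cases hε : ε = 0
  · subst hε
    have h1 := congrArg Prod.snd hq
    simp only [picardMap, zero_smul, sub_zero] at h1
    ext i
    simp [polyFlow_zero, h1]
  · obtain ⟨u, hu, hu1⟩ := isPolySolution_of_picardMap_eq hε hq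
    have hlt : |ε| < 2 * |ε| := by linarith [abs_pos.2 hε]
    simp only [hu.polyFlow_eq hlt]
    ext i
    exact (hu1 i).symm

theorem exists_isPolySolution_polyFlow (F : ι → MvPolynomial ι ℝ) (p : ι → ℝ) :
    ∃ a, 0 < a ∧ IsPolySolution F p (polyFlow F p) a := by
  obtain ⟨z, -, hz⟩ := exists_analyticAt_picardMap_inverse F p
  have hz' : ∀ᶠ ε in 𝓝[≠] (0 : ℝ),
      picardMap F (ε, z (p, ε)) = (ε, fun i => ContinuousMap.const _ (p i)) :=
    ((Continuous.prodMk_right p).tendsto 0).eventually hz |>.filter_mono nhdsWithin_le_nhds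
  obtain ⟨ε, hε, hne⟩ := (hz'.and self_mem_nhdsWithin).exists
  obtain ⟨u, hu, -⟩ := isPolySolution_of_picardMap_eq hne hε
  refine ⟨2 * |ε|, by have := abs_pos.2 hne; positivity, polyFlow_zero F p, fun s hs => ?_⟩
  rw [hu.polyFlow_eq (abs_lt.2 hs)]
  refine (hu.hasDerivAt s hs).congr_of_eventuallyEq ?_
  filter_upwards [isOpen_Ioo.mem_nhds hs] with t ht
  exact hu.polyFlow_eq (abs_lt.2 ht)

end PolynomialFlow
/-- The dependent variables of the EYM system written as a polynomial system in `x = 1/r`: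
`mass = m`, `lapse = S`, `radius = x`, `cosmo = Λ`, `gauge j = ω_{j+1}`,
`momentum j = r² dω_{j+1}/dr`, and `inv = 1 / (x² μ)`. -/
inductive EYMVar (n : ℕ) : Type
  | mass
  | lapse
  | radius
  | cosmo
  | inv
  | gauge (j : Fin n)
  | momentum (j : Fin n)

namespace EYMVar

instance (n : ℕ) : Finite (EYMVar n) := by
  refine Finite.of_injective (β := Fin 5 ⊕ Fin n ⊕ Fin n) (fun
    | mass => .inl 0
    | lapse => .inl 1
    | radius => .inl 2
    | cosmo => .inl 3
    | inv => .inl 4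
    | gauge j => .inr (.inl j)
    | momentum j => .inr (.inr j)) fun v w h => ?_
  cases v <;> cases w <;> simp_all

instance (n : ℕ) : Fintype (EYMVar n) := Fintype.ofFinite _

/-- The gauge field `ω_k`, extended by zero outside `1 ≤ k ≤ n`, as a function of the values of
all variables. -/
def gaugeExt {B : Type*} [Zero B] {n : ℕ} (y : EYMVar n → B) (k : ℕ) : B :=
  if h : 1 ≤ k ∧ k ≤ n then y (gauge ⟨k - 1, by omega⟩) else 0

theorem gaugeExt_zero {B : Type*} [Zero B] {n : ℕ} (y : EYMVar n → B) : gaugeExt y 0 = 0 := by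
  simp [gaugeExt]

theorem gaugeExt_of_lt {B : Type*} [Zero B] {n : ℕ} (y : EYMVar n → B) {k : ℕ} (hk : n < k) :
    gaugeExt y k = 0 := dif_neg (by omega)

theorem gaugeExt_succ {B : Type*} [Zero B] {n : ℕ} (y : EYMVar n → B) (j : Fin n) :
    gaugeExt y (j + 1) = y (gauge j) := by
  have h : 1 ≤ (j : ℕ) + 1 ∧ (j : ℕ) + 1 ≤ n := ⟨by omega, j.2⟩
  rw [gaugeExt, dif_pos h]
  rfl

variable {B : Type*} [CommRing B] [Algebra ℝ B] {N : ℕ}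

/-- `4 r⁴ p_θ`. -/
def pressure (N : ℕ) (y : EYMVar (N - 1) → B) : B :=
  ∑ k ∈ Finset.Icc 1 N,
    (gaugeExt y k ^ 2 - gaugeExt y (k - 1) ^ 2 - (N : B) - 1 + 2 * (k : B)) ^ 2

/-- `r⁴ G`. -/
def kinetic (y : EYMVar (N - 1) → B) : B := ∑ j, y (momentum j) ^ 2

/-- `x² μ`. -/
def metric (y : EYMVar (N - 1) → B) : B :=
  y radius ^ 2 - 2 * y mass * y radius ^ 3 - algebraMap ℝ B (1 / 3) * y cosmo

/-- `dm/dx`. -/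
def massRate (y : EYMVar (N - 1) → B) : B :=
  -(metric y * kinetic y + algebraMap ℝ B (1 / 4) * pressure N y)

/-- `d(x² μ)/dx`. -/
def metricRate (y : EYMVar (N - 1) → B) : B :=
  2 * y radius - 6 * y mass * y radius ^ 2 - 2 * y radius ^ 3 * massRate y

/-- `W_k`. -/
def potential (y : EYMVar (N - 1) → B) (k : ℕ) : B :=
  1 - gaugeExt y k ^ 2
    + algebraMap ℝ B (1 / 2) * (gaugeExt y (k - 1) ^ 2 + gaugeExt y (k + 1) ^ 2)

/-- The right-hand side of the EYM system with independent variable `x = 1/r`. -/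
def rate (y : EYMVar (N - 1) → B) : EYMVar (N - 1) → B
  | mass => massRate y
  | lapse => -2 * y radius ^ 3 * y lapse * kinetic y
  | radius => 1
  | cosmo => 0
  | inv => -y inv ^ 2 * metricRate y
  | gauge j => -y (momentum j)
  | momentum j => y inv * ((-2 * y radius + 6 * y mass * y radius ^ 2
      - algebraMap ℝ B (1 / 2) * y radius ^ 3 * pressure N y) * y (momentum j)
      + potential y (j + 1) * y (gauge j))

theorem map_rate {C : Type*} [CommRing C] [Algebra ℝ C] (f : B →ₐ[ℝ] C)
    (y : EYMVar (N - 1) → B) (i : EYMVar (N - 1)) :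
    f (rate y i) = rate (fun j => f (y j)) i := by
  have hg : ∀ k, f (gaugeExt y k) = gaugeExt (fun j => f (y j)) k := fun k => by
    unfold gaugeExt; split_ifs <;> simp
  cases i <;>
    simp [rate, massRate, metricRate, potential, metric, kinetic, pressure, hg, -one_div,
      map_ofNat, AlgHom.commutes]

/-- The polynomial vector field of the EYM system. -/
def field (N : ℕ) : EYMVar (N - 1) → MvPolynomial (EYMVar (N - 1)) ℝ := rate MvPolynomial.X

theorem polyField_field (y : EYMVar (N - 1) → ℝ) : polyField (field N) y = rate y := by
  ext i
  have := map_rate (MvPolynomial.aeval y) (MvPolynomial.X (R := ℝ)) i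
  simpa [polyField, field, MvPolynomial.aeval_eq_eval] using this

/-- Values of the variables at `x = 0` for given `(Λ, M, ω_∞, c)`. -/
def boundaryData {n : ℕ} (p : ℝ × ℝ × (Fin n → ℝ) × (Fin n → ℝ)) : EYMVar n → ℝ
  | mass => p.2.1
  | lapse => 1
  | radius => 0
  | cosmo => p.1
  | inv => -3 * p.1⁻¹
  | gauge j => p.2.2.1 j
  | momentum j => p.2.2.2 j

theorem analyticAt_boundaryData {n : ℕ} (p : ℝ × ℝ × (Fin n → ℝ) × (Fin n → ℝ)) (hp : p.1 ≠ 0) :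
    AnalyticAt ℝ boundaryData p := by
  refine AnalyticAt.pi fun i => ?_
  have hproj : ∀ (j : Fin n) (v : Fin n → ℝ), AnalyticAt ℝ (fun v : Fin n → ℝ => v j) v :=
    fun j v => (ContinuousLinearMap.proj (R := ℝ) (φ := fun _ : Fin n => ℝ) j).analyticAt v
  have h2 : AnalyticAt ℝ (fun p : ℝ × ℝ × (Fin n → ℝ) × (Fin n → ℝ) => p.2.2) p :=
    analyticAt_snd.comp analyticAt_snd
  cases i with
  | mass => exact analyticAt_fst.comp analyticAt_snd
  | lapse => exact analyticAt_const
  | radius => exact analyticAt_const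
  | cosmo => exact analyticAt_fst
  | inv => exact analyticAt_const.mul (analyticAt_fst.inv hp)
  | gauge j => exact (hproj j _).comp (analyticAt_fst.comp h2)
  | momentum j => exact (hproj j _).comp (analyticAt_snd.comp h2)

/-- The solution of the EYM system with data `p`, as a function of `(p, x)`. -/
def solution (N : ℕ) (q : (ℝ × ℝ × (Fin (N - 1) → ℝ) × (Fin (N - 1) → ℝ)) × ℝ) :
    EYMVar (N - 1) → ℝ :=
  polyFlow (field N) (boundaryData q.1) q.2

theorem solution_zero (p : ℝ × ℝ × (Fin (N - 1) → ℝ) × (Fin (N - 1) → ℝ)) :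
    solution N (p, 0) = boundaryData p := polyFlow_zero _ _

theorem analyticAt_solution (p : ℝ × ℝ × (Fin (N - 1) → ℝ) × (Fin (N - 1) → ℝ))
    (hp : p.1 ≠ 0) (i : EYMVar (N - 1)) :
    AnalyticAt ℝ (fun q => solution N q i) (p, 0) := by
  have h1 : AnalyticAt ℝ (fun q : (ℝ × ℝ × (Fin (N - 1) → ℝ) × (Fin (N - 1) → ℝ)) × ℝ =>
      (boundaryData q.1, q.2)) (p, 0) :=
    (AnalyticAt.comp (g := boundaryData) (analyticAt_boundaryData p hp) analyticAt_fst).prod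
      analyticAt_snd
  have h2 : AnalyticAt ℝ (solution N) (p, 0) :=
    AnalyticAt.comp (g := fun q : (EYMVar (N - 1) → ℝ) × ℝ => polyFlow (field N) q.1 q.2)
      (f := fun q : (ℝ × ℝ × (Fin (N - 1) → ℝ) × (Fin (N - 1) → ℝ)) × ℝ =>
        (boundaryData q.1, q.2))
      (analyticAt_polyFlow (field N) (boundaryData p)) h1
  exact ((ContinuousLinearMap.proj (R := ℝ) (φ := fun _ : EYMVar (N - 1) => ℝ) i).analyticAt
    _).comp h2

theorem eq_zero_of_hasDerivAt_eq_mul {u k : ℝ → ℝ} {a : ℝ} (ha : 0 < a)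
    (hk : ContinuousOn k (Set.Ioo (-a) a))
    (hu : ∀ s ∈ Set.Ioo (-a) a, HasDerivAt u (k s * u s) s) (h0 : u 0 = 0) :
    ∀ s ∈ Set.Ioo (-(a / 2)) (a / 2), u s = 0 := by
  obtain ⟨K, hK⟩ := isCompact_Icc.exists_bound_of_continuousOn
    (hk.mono (fun s (hs : s ∈ Set.Icc (-(a / 2)) (a / 2)) =>
      ⟨by linarith [hs.1], by linarith [hs.2]⟩))
  have := ODE_solution_unique_of_mem_Ioo (v := fun t y => k t * y) (s := fun _ => Set.univ)
    (K := K.toNNReal) (a := -(a / 2)) (b := a / 2) (t₀ := 0) (f := u) (g := fun _ => 0)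
    (fun t ht => ?_) ⟨by linarith, by linarith⟩
    (fun t ht => ⟨hu t ⟨by linarith [ht.1], by linarith [ht.2]⟩, trivial⟩)
    (fun t ht => ⟨by simpa using hasDerivAt_const t (0 : ℝ), trivial⟩) h0
  · exact this
  · refine (LipschitzWith.of_dist_le_mul fun x y => ?_).lipschitzOnWith
    have hkt := hK t (Set.Ioo_subset_Icc_self ht)
    rw [Real.dist_eq, Real.dist_eq, ← mul_sub, abs_mul]
    exact mul_le_mul_of_nonneg_right (hkt.trans (Real.le_coe_toNNReal K)) (abs_nonneg _)

/-- `solution N (p, ·)` satisfies the EYM system in `x = 1/r` on `(-a, a)`. -/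
structure SolvesOn (p : ℝ × ℝ × (Fin (N - 1) → ℝ) × (Fin (N - 1) → ℝ)) (a : ℝ) : Prop where
  hasDerivAt : ∀ s ∈ Set.Ioo (-a) a, ∀ i,
    HasDerivAt (fun x => solution N (p, x) i) (rate (solution N (p, s)) i) s
  radius_eq : ∀ s ∈ Set.Ioo (-a) a, solution N (p, s) radius = s
  cosmo_eq : ∀ s ∈ Set.Ioo (-a) a, solution N (p, s) cosmo = p.1
  inv_mul_metric : ∀ s ∈ Set.Ioo (-a) a,
    solution N (p, s) inv * metric (solution N (p, s)) = 1

theorem exists_solvesOn (p : ℝ × ℝ × (Fin (N - 1) → ℝ) × (Fin (N - 1) → ℝ))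
    (hp : p.1 ≠ 0) : ∃ a, 0 < a ∧ SolvesOn p a := by
  obtain ⟨a, ha, h0, hsol⟩ := exists_isPolySolution_polyFlow (field N) (boundaryData p)
  set y : ℝ → EYMVar (N - 1) → ℝ := fun x => solution N (p, x)
  have hd : ∀ s ∈ Set.Ioo (-a) a, ∀ i, HasDerivAt (fun x => y x i) (rate (y s) i) s := by
    intro s hs i
    have := hasDerivAt_pi.1 (hsol s hs) i
    rwa [polyField_field] at this
  have hy0 : y 0 = boundaryData p := h0
  have hmem0 : (0 : ℝ) ∈ Set.Ioo (-a) a := ⟨by linarith, ha⟩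
  have hconst : ∀ {f : ℝ → ℝ}, (∀ s ∈ Set.Ioo (-a) a, HasDerivAt f 0 s) →
      ∀ s ∈ Set.Ioo (-a) a, f s = f 0 := fun {f} hf s hs =>
    (convex_Ioo (-a) a).is_const_of_fderivWithin_eq_zero (𝕜 := ℝ)
      (fun t ht => (hf t ht).differentiableAt.differentiableWithinAt)
      (fun t ht => by
        rw [fderivWithin_of_isOpen isOpen_Ioo ht, (hf t ht).hasFDerivAt.fderiv]; ext; simp)
      hs hmem0
  have hradius : ∀ s ∈ Set.Ioo (-a) a, y s radius = s := by
    intro s hs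
    have := hconst (f := fun x => y x radius - x)
      (fun t ht => ((hd t ht radius).sub (hasDerivAt_id t)).congr_deriv (by simp [rate])) s hs
    simp only [hy0, boundaryData] at this
    linarith
  have hcosmo : ∀ s ∈ Set.Ioo (-a) a, y s cosmo = p.1 := by
    intro s hs
    have := hconst (f := fun x => y x cosmo) (fun t ht => hd t ht cosmo) s hs
    simpa only [hy0, boundaryData] using this
  have hmetric : ∀ s ∈ Set.Ioo (-a) a,
      HasDerivAt (fun x => metric (y x)) (metricRate (y s)) s := by
    intro s hs
    have h := (((hd s hs radius).pow 2).sub (((hd s hs mass).const_mul 2).mul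
      ((hd s hs radius).pow 3))).sub ((hd s hs cosmo).const_mul (algebraMap ℝ ℝ (1 / 3)))
    refine h.congr_deriv ?_
    simp only [rate, metricRate]
    norm_num
    ring
  have hcont : ∀ i, ContinuousOn (fun x => y x i) (Set.Ioo (-a) a) := fun i =>
    HasDerivAt.continuousOn fun s hs => hd s hs i
  have hgauge : ∀ k, ContinuousOn (fun x => gaugeExt (y x) k) (Set.Ioo (-a) a) := fun k => by
    unfold gaugeExt
    split_ifs
    · exact hcont _
    · exact continuousOn_const
  have hrate : ContinuousOn (fun x => -(y x inv * metricRate (y x))) (Set.Ioo (-a) a) := by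
    simp only [metricRate, massRate, metric, kinetic, pressure]
    have := hcont inv
    have := hcont radius
    have := hcont mass
    have := hcont cosmo
    fun_prop
  have hu := eq_zero_of_hasDerivAt_eq_mul (u := fun x => 1 - y x inv * metric (y x)) ha hrate
    (fun s hs => by
      refine (((hd s hs inv).mul (hmetric s hs)).const_sub 1).congr_deriv ?_
      simp only [rate]
      ring)
    (by simp only [hy0, boundaryData, metric]; norm_num; field_simp; norm_num)
  have hsub : ∀ s ∈ Set.Ioo (-(a / 2)) (a / 2), s ∈ Set.Ioo (-a) a := fun s hs =>
    ⟨by linarith [hs.1], by linarith [hs.2]⟩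
  exact ⟨a / 2, by linarith, fun s hs => hd s (hsub s hs), fun s hs => hradius s (hsub s hs),
    fun s hs => hcosmo s (hsub s hs), fun s hs => by linarith [hu s hs]⟩

theorem isBigO_solution (p : ℝ × ℝ × (Fin (N - 1) → ℝ) × (Fin (N - 1) → ℝ))
    (hp : p.1 ≠ 0) (i : EYMVar (N - 1)) :
    (fun r : ℝ => solution N (p, 1 / r) i - boundaryData p i) =O[atTop] fun r : ℝ => 1 / r := by
  have hd : DifferentiableAt ℝ (fun x : ℝ => solution N (p, x) i) 0 := by
    have h : AnalyticAt ℝ (fun x : ℝ => solution N (p, x) i) 0 :=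
      AnalyticAt.comp (g := fun q => solution N q i) (f := fun x : ℝ => (p, x))
        (analyticAt_solution p hp i) (analyticAt_const.prod analyticAt_id)
    exact h.differentiableAt
  have h := hd.isBigO_sub.comp_tendsto (tendsto_inv_atTop_zero (𝕜 := ℝ))
  simpa only [Function.comp_def, solution_zero, sub_zero, one_div] using h

section

variable {p : ℝ × ℝ × (Fin (N - 1) → ℝ) × (Fin (N - 1) → ℝ)} {a r : ℝ}

theorem one_div_mem_Ioo (ha : 0 < a) (hr : 1 / a < r) : 1 / r ∈ Set.Ioo (-a) a := by
  have hr0 : 0 < r := (one_div_pos.2 ha).trans hr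
  have := one_div_pos.2 hr0
  exact ⟨by linarith, (one_div_lt ha hr0).1 hr⟩

theorem SolvesOn.hasDerivAt_one_div (h : SolvesOn p a) (ha : 0 < a) (hr : 1 / a < r)
    (i : EYMVar (N - 1)) :
    HasDerivAt (fun r => solution N (p, 1 / r) i)
      (rate (solution N (p, 1 / r)) i * (-(1 / r ^ 2))) r := by
  have hr0 : r ≠ 0 := ((one_div_pos.2 ha).trans hr).ne'
  have hinv : HasDerivAt (fun r : ℝ => 1 / r) (-(1 / r ^ 2)) r := by
    simpa only [one_div] using hasDerivAt_inv hr0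
  exact (h.hasDerivAt _ (one_div_mem_Ioo ha hr) i).comp r hinv

theorem SolvesOn.hasDerivAt_gaugeExt (h : SolvesOn p a) (ha : 0 < a) (hr : 1 / a < r)
    (j : Fin (N - 1)) :
    HasDerivAt (fun r => gaugeExt (solution N (p, 1 / r)) (j + 1))
      (solution N (p, 1 / r) (momentum j) / r ^ 2) r := by
  simp only [gaugeExt_succ]
  refine (h.hasDerivAt_one_div ha hr (gauge j)).congr_deriv ?_
  simp only [rate]
  ring

theorem SolvesOn.hasDerivAt_deriv_gaugeExt (h : SolvesOn p a) (ha : 0 < a) (hr : 1 / a < r)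
    (j : Fin (N - 1)) :
    HasDerivAt (deriv fun r => gaugeExt (solution N (p, 1 / r)) (j + 1))
      (-rate (solution N (p, 1 / r)) (momentum j) / r ^ 4
        - 2 * solution N (p, 1 / r) (momentum j) / r ^ 3) r := by
  have hr0 : r ≠ 0 := ((one_div_pos.2 ha).trans hr).ne'
  have hd := (h.hasDerivAt_one_div ha hr (momentum j)).div (hasDerivAt_pow 2 r)
    (pow_ne_zero 2 hr0)
  refine (hd.congr_of_eventuallyEq ?_).congr_deriv ?_
  · filter_upwards [isOpen_Ioi.mem_nhds hr] with t ht
    exact (h.hasDerivAt_gaugeExt ha ht j).deriv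
  · simp only [Nat.cast_ofNat]
    field_simp
    ring

theorem SolvesOn.GF_eq (h : SolvesOn p a) (ha : 0 < a) (hr : 1 / a < r) :
    GF N (fun k r => gaugeExt (solution N (p, 1 / r)) k) r =
      kinetic (solution N (p, 1 / r)) / r ^ 4 := by
  rw [GF, kinetic, Finset.sum_div, ← Finset.Ico_succ_right_eq_Icc, Finset.sum_Ico_eq_sum_range,
    ← Fin.sum_univ_eq_sum_range
      (fun k => deriv (fun r => gaugeExt (solution N (p, 1 / r)) (1 + k)) r ^ 2)]
  refine Finset.sum_congr rfl fun j _ => ?_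
  rw [add_comm 1 (j : ℕ), (h.hasDerivAt_gaugeExt ha hr j).deriv]
  ring

theorem SolvesOn.eym (h : SolvesOn p a) (hN : N - 1 < N) (ha : 0 < a) (hr : 1 / a < r) :
    EYM N p.1 (fun r => solution N (p, 1 / r) mass) (fun r => solution N (p, 1 / r) lapse)
      (fun k r => gaugeExt (solution N (p, 1 / r)) k) r := by
  have hr0 : r ≠ 0 := ((one_div_pos.2 ha).trans hr).ne'
  have hmem := one_div_mem_Ioo ha hr
  have hmetric : metric (solution N (p, 1 / r)) =
      muF p.1 (fun r => solution N (p, 1 / r) mass) r / r ^ 2 := by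
    simp only [metric, h.radius_eq _ hmem, h.cosmo_eq _ hmem, muF, Algebra.algebraMap_self,
      RingHom.id_apply]
    field_simp
  have hpress : pTheta N (fun k r => gaugeExt (solution N (p, 1 / r)) k) r =
      1 / (4 * r ^ 4) * pressure N (solution N (p, 1 / r)) := rfl
  refine ⟨gaugeExt_zero _, gaugeExt_of_lt _ hN, ?_, ?_, fun k hk => ?_⟩
  · refine (h.hasDerivAt_one_div ha hr mass).congr_deriv ?_
    simp only [rate, massRate, h.GF_eq ha hr, hpress, hmetric, Algebra.algebraMap_self,
      RingHom.id_apply]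
    field_simp
  · refine (h.hasDerivAt_one_div ha hr lapse).congr_deriv ?_
    simp only [rate, h.GF_eq ha hr, h.radius_eq _ hmem]
    field_simp
  · obtain ⟨hk1, hk2⟩ := Finset.mem_Icc.1 hk
    obtain ⟨j, rfl⟩ : ∃ j : Fin (N - 1), (j : ℕ) + 1 = k :=
      ⟨⟨k - 1, by omega⟩, by simp only; omega⟩
    have hd := h.hasDerivAt_gaugeExt ha hr j
    have hdd := h.hasDerivAt_deriv_gaugeExt ha hr j
    refine ⟨hd.differentiableAt, hdd.differentiableAt, ?_⟩
    have hW : WF (fun k r => gaugeExt (solution N (p, 1 / r)) k) (j + 1) r =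
        potential (solution N (p, 1 / r)) (j + 1) := rfl
    have hinv : solution N (p, 1 / r) inv *
        muF p.1 (fun r => solution N (p, 1 / r) mass) r = r ^ 2 := by
      have := h.inv_mul_metric _ hmem
      rw [hmetric] at this
      field_simp at this
      exact this
    have hmu : muF p.1 (fun r => solution N (p, 1 / r) mass) r =
      1 - 2 * solution N (p, 1 / r) mass / r - p.1 * r ^ 2 / 3 := rfl
    rw [hd.deriv, hdd.deriv, hW, hpress]
    simp only [gaugeExt_succ, rate, h.radius_eq _ hmem, Algebra.algebraMap_self,
      RingHom.id_apply]
    generalize hE : (-2 * (1 / r) + 6 * solution N (p, 1 / r) mass * (1 / r) ^ 2 -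
      1 / 2 * (1 / r) ^ 3 * pressure N (solution N (p, 1 / r))) *
      solution N (p, 1 / r) (momentum j) +
      potential (solution N (p, 1 / r)) (j + 1) * solution N (p, 1 / r) (gauge j) = E
    have hsplit : r ^ 2 * muF p.1 (fun r => solution N (p, 1 / r) mass) r *
        (-(solution N (p, 1 / r) inv * E) / r ^ 4
          - 2 * solution N (p, 1 / r) (momentum j) / r ^ 3) =
        -E - 2 * muF p.1 (fun r => solution N (p, 1 / r) mass) r *
          solution N (p, 1 / r) (momentum j) / r := by
      field_simp
      linear_combination (-E) * hinv
    rw [hsplit, hmu, ← hE]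
    field_simp
    ring

end

end EYMVar

/-- **Local existence near infinity.** For every Λ < 0, M ∈ ℝ and arbitrary asymptotic
data (ω_{1,∞}, …, ω_{N−1,∞}) and (c_1, …, c_{N−1}), there exist R > 0 and a solution of
the su(N) EYM equations on (R, ∞) with m = M + O(1/r), S = 1 + O(1/r),
ω_j = ω_{j,∞} + O(1/r), r²ω_j′ = c_j + O(1/r), all field variables being analytic
functions of 1/r at 1/r = 0 and depending analytically on the 2N parameters
(Λ, M, ω_{j,∞}, c_j). In particular no constraint is imposed on the ω_{j,∞}. -/
theorem local_existence_infinity (N : ℕ) (hN : 2 ≤ N) :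
    ∃ (R : ℝ × ℝ × (Fin (N - 1) → ℝ) × (Fin (N - 1) → ℝ) → ℝ)
      (mF SF : ℝ × ℝ × (Fin (N - 1) → ℝ) × (Fin (N - 1) → ℝ) → ℝ → ℝ)
      (ωF : ℝ × ℝ × (Fin (N - 1) → ℝ) × (Fin (N - 1) → ℝ) → ℕ → ℝ → ℝ)
      (mA SA : (ℝ × ℝ × (Fin (N - 1) → ℝ) × (Fin (N - 1) → ℝ)) × ℝ → ℝ)
      (ωA : ℕ → (ℝ × ℝ × (Fin (N - 1) → ℝ) × (Fin (N - 1) → ℝ)) × ℝ → ℝ),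
      ∀ (Λ M : ℝ) (wi c : Fin (N - 1) → ℝ), Λ < 0 →
        0 < R (Λ, M, wi, c) ∧
        (∀ r ∈ Set.Ioi (R (Λ, M, wi, c)),
          EYM N Λ (mF (Λ, M, wi, c)) (SF (Λ, M, wi, c)) (ωF (Λ, M, wi, c)) r) ∧
        ((fun r : ℝ => mF (Λ, M, wi, c) r - M) =O[atTop] fun r : ℝ => 1 / r) ∧
        ((fun r : ℝ => SF (Λ, M, wi, c) r - 1) =O[atTop] fun r : ℝ => 1 / r) ∧
        (∀ j : Fin (N - 1),
          ((fun r : ℝ => ωF (Λ, M, wi, c) ((j : ℕ) + 1) r - wi j)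
              =O[atTop] fun r : ℝ => 1 / r) ∧
          ((fun r : ℝ => r ^ 2 * deriv (ωF (Λ, M, wi, c) ((j : ℕ) + 1)) r - c j)
              =O[atTop] fun r : ℝ => 1 / r)) ∧
        AnalyticAt ℝ mA ((Λ, M, wi, c), 0) ∧
        AnalyticAt ℝ SA ((Λ, M, wi, c), 0) ∧
        (∀ j ∈ Finset.Icc 1 (N - 1), AnalyticAt ℝ (ωA j) ((Λ, M, wi, c), 0)) ∧
        mA ((Λ, M, wi, c), 0) = M ∧ SA ((Λ, M, wi, c), 0) = 1 ∧
        (∀ r ∈ Set.Ioi (R (Λ, M, wi, c)),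
          mF (Λ, M, wi, c) r = mA ((Λ, M, wi, c), 1 / r) ∧
          SF (Λ, M, wi, c) r = SA ((Λ, M, wi, c), 1 / r) ∧
          ∀ j ∈ Finset.Icc 1 (N - 1),
            ωF (Λ, M, wi, c) j r = ωA j ((Λ, M, wi, c), 1 / r)) := by
  have hspec : ∀ p : ℝ × ℝ × (Fin (N - 1) → ℝ) × (Fin (N - 1) → ℝ), ∃ a, 0 < a ∧
      (p.1 ≠ 0 → EYMVar.SolvesOn p a) := fun p => by
    by_cases hp : p.1 = 0
    · exact ⟨1, one_pos, fun h => absurd hp h⟩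
    · obtain ⟨a, ha, h⟩ := EYMVar.exists_solvesOn p hp
      exact ⟨a, ha, fun _ => h⟩
  choose a ha hsol using hspec
  refine ⟨fun p => 1 / a p, fun p r => EYMVar.solution N (p, 1 / r) .mass,
    fun p r => EYMVar.solution N (p, 1 / r) .lapse,
    fun p k r => EYMVar.gaugeExt (EYMVar.solution N (p, 1 / r)) k,
    fun q => EYMVar.solution N q .mass, fun q => EYMVar.solution N q .lapse,
    fun k q => EYMVar.gaugeExt (EYMVar.solution N q) k, fun Λ M wi c hΛ => ?_⟩
  set p : ℝ × ℝ × (Fin (N - 1) → ℝ) × (Fin (N - 1) → ℝ) := (Λ, M, wi, c) with hp_def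
  have hp : p.1 ≠ 0 := hΛ.ne
  have hpa := one_div_pos.2 (ha p)
  refine ⟨hpa, fun r hr => (hsol p hp).eym (by omega) (ha p) hr,
    EYMVar.isBigO_solution p hp .mass, EYMVar.isBigO_solution p hp .lapse, fun j => ⟨?_, ?_⟩,
    EYMVar.analyticAt_solution p hp _, EYMVar.analyticAt_solution p hp _, fun k _ => ?_,
    by simp [EYMVar.solution_zero, EYMVar.boundaryData, hp_def],
    by simp [EYMVar.solution_zero, EYMVar.boundaryData], fun r _ => ⟨rfl, rfl, fun _ _ => rfl⟩⟩
  · simp only [EYMVar.gaugeExt_succ]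
    exact EYMVar.isBigO_solution p hp (.gauge j)
  · refine (EYMVar.isBigO_solution p hp (.momentum j)).congr' ?_ EventuallyEq.rfl
    filter_upwards [eventually_gt_atTop (1 / a p)] with r hr
    have hr0 : r ≠ 0 := (hpa.trans hr).ne'
    rw [((hsol p hp).hasDerivAt_gaugeExt (ha p) hr j).deriv]
    simp only [EYMVar.boundaryData, hp_def]
    field_simp
  · simp only [EYMVar.gaugeExt]
    split_ifs
    · exact EYMVar.analyticAt_solution p hp _
    · exact analyticAt_const
end
end
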